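/- arXiv:1303.1427 — 7 statements merged into one kernel-verified Lean document; each statement's English description precedes it below -/
import Mathlib

section
/- Let X be a bounded G-lattice. Then the Protasov density dominates the upper Banach density: for every a ∈ X and every measure μ on X, one has inf_{g ∈ G} μ(g•a) ≤ p_X(a). -/
/-- `G = F·D`: every element of `G` is a product `f * d` with `f ∈ F`, `d ∈ D`. -/
def Covers {G : Type*} [Group G] (F D : Set G) : Prop :=
  ∀ g : G, ∃ f ∈ F, ∃ d ∈ D, g = f * d

/-- The difference set `Δ(a) = {g ∈ G : (g • a) ⊓ a ≠ ⊥}`. -/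
def deltaSet (G : Type*) [Group G] {X : Type*} [Lattice X] [BoundedOrder X]
    [MulAction G X] (a : X) : Set G :=
  {g : G | (g • a) ⊓ a ≠ ⊥}

/-- The covering number of `D ⊆ G`: the least cardinality of a finite `F ⊆ G`
with `G = F·D`, and `⊤` if no such finite `F` exists. -/
noncomputable def covNum (G : Type*) [Group G] (D : Set G) : ℕ∞ :=
  sInf {c : ℕ∞ | ∃ F : Finset G, (F.card : ℕ∞) = c ∧ Covers (↑F : Set G) D}

/-- The Protasov density `p_X(a)`. -/
noncomputable def protasov (G : Type*) [Group G] {X : Type*} [Lattice X] [BoundedOrder X]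
    [MulAction G X] (a : X) : ℝ :=
  if 0 < covNum G (deltaSet G a) ∧ covNum G (deltaSet G a) < ⊤ then
    1 / ((covNum G (deltaSet G a)).toNat : ℝ)
  else 0

/-- A measure on a bounded lattice `X`. -/
structure IsMeasure {X : Type*} [Lattice X] [BoundedOrder X] (μ : X → ℝ) : Prop where
  map_bot : μ ⊥ = 0
  map_top : μ ⊤ = 1
  mono : ∀ ⦃a b : X⦄, a ≤ b → μ a ≤ μ b
  subadd : ∀ a b : X, μ (a ⊔ b) ≤ μ a + μ b
  additive : ∀ (k : ℕ) (f : Fin k → X), (∀ i j, i ≠ j → f i ⊓ f j = ⊥) →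
    μ (Finset.univ.sup f) = ∑ i, μ (f i)

theorem covNum_le_card {G : Type*} [Group G] {D : Set G} {F : Finset G}
    (h : Covers (↑F : Set G) D) : covNum G D ≤ F.card :=
  sInf_le ⟨F, rfl, h⟩

theorem covNum_pos {G : Type*} [Group G] (D : Set G) : 0 < covNum G D := by
  refine zero_lt_one.trans_le (le_sInf ?_)
  rintro c ⟨F, rfl, hF⟩
  obtain ⟨f, hf, -⟩ := hF 1
  exact_mod_cast Finset.card_pos.mpr ⟨f, hf⟩

section Lattice

variable {G : Type*} [Group G] {X : Type*} [Lattice X] [BoundedOrder X] [MulAction G X]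

theorem smul_bot_of_smul_inf (hinf : ∀ (g : G) (x y : X), g • (x ⊓ y) = g • x ⊓ g • y)
    (g : G) : g • (⊥ : X) = ⊥ := by
  simpa using hinf g ⊥ (g⁻¹ • ⊥)

/-- There are disjoint families of translates of `a` of every length up to the covering number
of the difference set of `a`. -/
theorem exists_disjoint_translates
    (hinf : ∀ (g : G) (x y : X), g • (x ⊓ y) = g • x ⊓ g • y) (a : X) (n : ℕ)
    (hn : (n : ℕ∞) ≤ covNum G (deltaSet G a)) :
    ∃ f : Fin n → G, ∀ i j, i ≠ j → f i • a ⊓ f j • a = ⊥ := by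
  classical
  induction n with
  | zero => exact ⟨Fin.elim0, fun i => i.elim0⟩
  | succ n ih =>
    obtain ⟨f, hf⟩ := ih ((Nat.cast_le.mpr n.le_succ).trans hn)
    have hcov : ¬ Covers (↑(Finset.univ.image f) : Set G) (deltaSet G a) := by
      intro h
      have h₁ := hn.trans (covNum_le_card h)
      have h₂ : (Finset.univ.image f).card ≤ n := by
        simpa using Finset.card_image_le (s := Finset.univ) (f := f)
      have h₃ : n + 1 ≤ (Finset.univ.image f).card := by exact_mod_cast h₁
      omega
    simp only [Covers, not_forall] at hcov
    obtain ⟨g, hg⟩ := hcov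
    have hgf : ∀ i, g • a ⊓ f i • a = ⊥ := by
      intro i
      by_contra hne
      refine hg ⟨f i, by simp, (f i)⁻¹ * g, fun h => hne ?_, by group⟩
      have := congrArg (f i • ·) h
      simpa [hinf, smul_smul, smul_bot_of_smul_inf hinf] using this
    refine ⟨Fin.cons g f, fun i j => ?_⟩
    refine Fin.cases ?_ (fun i => ?_) i <;> refine Fin.cases ?_ (fun j => ?_) j
    · simp
    · simpa using fun _ => hgf j
    · simpa [inf_comm] using hgf i
    · simpa using hf i j

theorem natCast_mul_sInf_le_one
    (hinf : ∀ (g : G) (x y : X), g • (x ⊓ y) = g • x ⊓ g • y) (a : X)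
    {μ : X → ℝ} (hμ : IsMeasure μ) (n : ℕ) (hn : (n : ℕ∞) ≤ covNum G (deltaSet G a)) :
    n * sInf (Set.range fun g : G => μ (g • a)) ≤ 1 := by
  obtain ⟨f, hf⟩ := exists_disjoint_translates hinf a n hn
  have hbdd : BddBelow (Set.range fun g : G => μ (g • a)) := by
    refine ⟨0, ?_⟩
    rintro _ ⟨g, rfl⟩
    exact hμ.map_bot ▸ hμ.mono bot_le
  calc n * sInf (Set.range fun g : G => μ (g • a))
      = ∑ _i : Fin n, sInf (Set.range fun g : G => μ (g • a)) := by simp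
    _ ≤ ∑ i, μ (f i • a) := Finset.sum_le_sum fun i _ => csInf_le hbdd ⟨f i, rfl⟩
    _ = μ (Finset.univ.sup fun i => f i • a) := (hμ.additive n _ hf).symm
    _ ≤ μ ⊤ := hμ.mono le_top
    _ = 1 := hμ.map_top

end Lattice

/-- The Protasov density dominates the upper Banach density: for every `a ∈ X` and
every measure `μ` on `X`, `inf_{g ∈ G} μ (g • a) ≤ p_X(a)`. -/
theorem protasov_ge_upper_banach
    {G : Type*} [Group G] {X : Type*} [Lattice X] [BoundedOrder X] [MulAction G X]
    (hbt : (⊥ : X) ≠ ⊤)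
    (hsup : ∀ (g : G) (x y : X), g • (x ⊔ y) = g • x ⊔ g • y)
    (hinf : ∀ (g : G) (x y : X), g • (x ⊓ y) = g • x ⊓ g • y)
    (a : X) (μ : X → ℝ) (hμ : IsMeasure μ) :
    sInf (Set.range fun g : G => μ (g • a)) ≤ protasov G a := by
  have key := natCast_mul_sInf_le_one hinf a hμ
  have hpos := covNum_pos (deltaSet G a)
  unfold protasov
  split_ifs with h
  · obtain ⟨n, hn⟩ := ENat.ne_top_iff_exists.mp h.2.ne
    rw [← hn] at key hpos ⊢
    have hn0 : (0 : ℝ) < n := by exact_mod_cast hpos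
    rw [ENat.toNat_natCast, le_div_iff₀ hn0, mul_comm]
    exact key n le_rfl
  · have htop : covNum G (deltaSet G a) = ⊤ := by
      by_contra hne
      exact h ⟨hpos, lt_top_iff_ne_top.mpr hne⟩
    by_contra! hs
    obtain ⟨n, hn⟩ := exists_nat_gt (1 / sInf (Set.range fun g : G => μ (g • a)))
    rw [div_lt_iff₀ hs] at hn
    exact hn.not_ge (key n (htop ▸ le_top))
end

section
/- Let X be a 0-distributive bounded G-lattice and n ≥ 1 an integer. Then the n-th subadditivity defect of the Protasov density at ⊤ satisfies ∂ⁿp_X(⊤) ≤ 1 − 1/φ(n+1); explicitly, for every finite subset A ⊆ X with |A| ≤ n and ⋁A = ⊤ one has Σ_{a∈A} p_X(a) ≥ 1/φ(n+1). -/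
/-- `φ(m) = sup_{1 < x < m} (x^{m-x} - 1)/(x - 1)` (with `φ(1) = 0`, as the set is empty). -/
noncomputable def phiR (m : ℕ) : ℝ :=
  sSup ((fun x : ℝ => (x ^ ((m : ℝ) - x) - 1) / (x - 1)) '' Set.Ioo 1 (m : ℝ))

theorem smul_mono_of_smul_sup {G X : Type*} [Group G] [Lattice X] [MulAction G X]
    (hsup : ∀ (g : G) (x y : X), g • (x ⊔ y) = g • x ⊔ g • y) (g : G) {x y : X} (h : x ≤ y) :
    g • x ≤ g • y := by
  rw [← sup_eq_right, ← hsup, sup_eq_right.2 h]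

section Bounds

variable {G : Type*} [Group G] {X : Type*} [Lattice X] [BoundedOrder X] [MulAction G X]

theorem smul_bot_of_smul_sup
    (hsup : ∀ (g : G) (x y : X), g • (x ⊔ y) = g • x ⊔ g • y) (g : G) : g • (⊥ : X) = ⊥ := by
  have h := smul_mono_of_smul_sup hsup g (bot_le : (⊥ : X) ≤ g⁻¹ • ⊥)
  rw [smul_inv_smul] at h
  exact le_bot_iff.1 h

theorem smul_finset_sup
    (hsup : ∀ (g : G) (x y : X), g • (x ⊔ y) = g • x ⊔ g • y) {ι : Type*} (g : G)
    (s : Finset ι) (u : ι → X) : g • s.sup u = s.sup fun i => g • u i :=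
  Finset.apply_sup_eq_sup_comp (fun x => g • x) (hsup g) (smul_bot_of_smul_sup hsup g)

theorem inf_finset_sup_eq_bot
    (h0dist : ∀ x y z : X, x ⊓ y = ⊥ → x ⊓ (y ⊔ z) = x ⊓ z) {ι : Type*} (s : Finset ι)
    (u : ι → X) (x : X) (h : ∀ i ∈ s, x ⊓ u i = ⊥) : x ⊓ s.sup u = ⊥ := by
  classical
  induction s using Finset.induction_on with
  | empty => simp
  | insert i s _ ih =>
    rw [Finset.sup_insert, h0dist _ _ _ (h i (Finset.mem_insert_self i s))]
    exact ih fun j hj => h j (Finset.mem_insert_of_mem hj)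

/-- `x` lies below a join of translates of the elements `a i`, in which `a i` is
translated at most `f i` times. -/
def TranslateBound (G : Type*) [Group G] {X : Type*} [Lattice X] [BoundedOrder X]
    [MulAction G X] {ι : Type*} [Fintype ι] (a : ι → X) (x : X) (f : ι → ℕ) : Prop :=
  ∃ F : ι → Finset G, (∀ i, (F i).card ≤ f i) ∧
    x ≤ Finset.univ.sup fun i => (F i).sup fun g => g • a i

namespace TranslateBound

variable {ι : Type*} [Fintype ι] {a : ι → X} {x x' : X} {f f' : ι → ℕ}

theorem mono (h : TranslateBound G a x f) (hx : x' ≤ x) (hf : ∀ i, f i ≤ f' i) :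
    TranslateBound G a x' f' :=
  let ⟨F, hF, hxF⟩ := h
  ⟨F, fun i => (hF i).trans (hf i), hx.trans hxF⟩

theorem bot : TranslateBound G a ⊥ 0 :=
  ⟨fun _ => ∅, by simp, bot_le⟩

theorem eq_bot (h : TranslateBound G a x f) (hf : ∀ i, f i = 0) : x = ⊥ := by
  obtain ⟨F, hF, hxF⟩ := h
  have hF0 : ∀ i, F i = ∅ := fun i => Finset.card_eq_zero.1 (by have := hF i; have := hf i; omega)
  simpa [hF0] using hxF

theorem sup (h : TranslateBound G a x f) (h' : TranslateBound G a x' f') :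
    TranslateBound G a (x ⊔ x') (f + f') := by
  classical
  obtain ⟨F, hF, hxF⟩ := h
  obtain ⟨F', hF', hxF'⟩ := h'
  refine ⟨fun i => F i ∪ F' i, fun i => (Finset.card_union_le _ _).trans
    (add_le_add (hF i) (hF' i)), sup_le (hxF.trans ?_) (hxF'.trans ?_)⟩
  · exact Finset.sup_mono_fun fun i _ => Finset.sup_mono Finset.subset_union_left
  · exact Finset.sup_mono_fun fun i _ => Finset.sup_mono Finset.subset_union_right

theorem finset_sup {κ : Type*} (s : Finset κ) (u : κ → X) (w : κ → ι → ℕ)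
    (h : ∀ q ∈ s, TranslateBound G a (u q) (w q)) :
    TranslateBound G a (s.sup u) (∑ q ∈ s, w q) := by
  classical
  induction s using Finset.induction_on with
  | empty => exact bot
  | insert q s hq ih =>
    rw [Finset.sup_insert, Finset.sum_insert hq]
    exact (h q (Finset.mem_insert_self q s)).sup
      (ih fun i hi => h i (Finset.mem_insert_of_mem hi))

theorem self [DecidableEq ι] (i : ι) : TranslateBound G a (a i) (Pi.single i 1) := by
  refine ⟨fun j => if j = i then {1} else ∅, fun j => ?_, ?_⟩
  · by_cases hj : j = i
    · subst hj; simp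
    · simp [hj]
  · refine le_trans ?_ (Finset.le_sup (Finset.mem_univ i))
    simp

theorem smul (hsup : ∀ (g : G) (x y : X), g • (x ⊔ y) = g • x ⊔ g • y)
    (h : TranslateBound G a x f) (g : G) : TranslateBound G a (g • x) f := by
  classical
  obtain ⟨F, hF, hxF⟩ := h
  refine ⟨fun i => (F i).image (g * ·), fun i => Finset.card_image_le.trans (hF i),
    (smul_mono_of_smul_sup hsup g hxF).trans ?_⟩
  rw [smul_finset_sup hsup]
  refine Finset.sup_mono_fun fun i _ => ?_
  rw [smul_finset_sup hsup, Finset.sup_image]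
  exact Finset.sup_mono_fun fun k _ => by simp [mul_smul]

/-- If few translates of `a j` occur in a cover of `⊤`, then some translate of `a j` is
disjoint from all of them, so `a j` is bounded by translates of the other elements. -/
theorem eliminate (hsup : ∀ (g : G) (x y : X), g • (x ⊔ y) = g • x ⊔ g • y)
    (hinf : ∀ (g : G) (x y : X), g • (x ⊓ y) = g • x ⊓ g • y)
    (h0dist : ∀ x y z : X, x ⊓ y = ⊥ → x ⊓ (y ⊔ z) = x ⊓ z) [DecidableEq ι]
    {s : ℕ} {j : ι}
    (hj : ∀ F : Finset G, F.card ≤ s → ¬ Covers (↑F : Set G) (deltaSet G (a j)))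
    (h : TranslateBound G a ⊤ f) (hfj : f j ≤ s) :
    TranslateBound G a (a j) (Function.update f j 0) := by
  obtain ⟨F, hF, hxF⟩ := h
  have hnc := hj (F j) ((hF j).trans hfj)
  unfold Covers at hnc
  push Not at hnc
  obtain ⟨g, hg⟩ := hnc
  have hdisj : ∀ k ∈ F j, g • a j ⊓ k • a j = ⊥ := by
    intro k hk
    by_contra hne
    refine hg k hk (k⁻¹ * g) (fun h0 => hne ?_) (by group)
    have := congrArg (fun z => k • z) h0
    simpa [hinf, mul_smul, smul_bot_of_smul_sup hsup] using this
  have hrest : TranslateBound G a (g • a j) (Function.update f j 0) := by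
    refine ⟨Function.update F j ∅, fun i => ?_, ?_⟩
    · by_cases hi : i = j
      · subst hi; simp
      · simpa [hi] using hF i
    · set rest := Finset.univ.sup fun i => (Function.update F j ∅ i).sup fun k => k • a i
        with hrestdef
      have htop : (⊤ : X) ≤ ((F j).sup fun k => k • a j) ⊔ rest := by
        refine hxF.trans (Finset.sup_le fun i _ => ?_)
        by_cases hi : i = j
        · subst hi; exact le_sup_left
        · refine le_trans ?_ le_sup_right
          have := Finset.le_sup (f := fun i => (Function.update F j ∅ i).sup fun k => k • a i)
            (Finset.mem_univ i)
          simpa [hi] using this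
      have h1 := h0dist (g • a j) ((F j).sup fun k => k • a j) rest
        (inf_finset_sup_eq_bot h0dist _ _ _ hdisj)
      rw [top_le_iff.1 htop, inf_top_eq] at h1
      exact inf_eq_left.1 h1.symm
  simpa using hrest.smul hsup g⁻¹

end TranslateBound

/-- For every ordering of the elements `a i`, the first one is bounded by translates of the
others, the element in position `v` being translated at most `y v` times. -/
def OrderedBound (G : Type*) [Group G] {X : Type*} [Lattice X] [BoundedOrder X]
    [MulAction G X] {m : ℕ} (a : Fin (m + 1) → X) (y : ℕ → ℕ) : Prop :=
  ∀ p : Equiv.Perm (Fin (m + 1)),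
    TranslateBound G a (a (p.symm 0)) fun i => if p i = 0 then 0 else y (p i)

theorem OrderedBound.mono {m : ℕ} {a : Fin (m + 1) → X} {y y' : ℕ → ℕ}
    (h : OrderedBound G a y) (hy : ∀ v, 1 ≤ v → y v ≤ y' v) : OrderedBound G a y' := fun p =>
  (h p).mono le_rfl fun i => by
    split_ifs with h0
    · exact le_rfl
    · exact hy _ (Nat.one_le_iff_ne_zero.2 fun h1 => h0 (Fin.ext h1))

theorem OrderedBound.step (hsup : ∀ (g : G) (x y : X), g • (x ⊔ y) = g • x ⊔ g • y)
    (hinf : ∀ (g : G) (x y : X), g • (x ⊓ y) = g • x ⊓ g • y)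
    (h0dist : ∀ x y z : X, x ⊓ y = ⊥ → x ⊓ (y ⊔ z) = x ⊓ z)
    {s m k r : ℕ} (hkr : k + r = m) {a : Fin (m + 1) → X} (htop : Finset.univ.sup a = ⊤)
    (hs : ∀ j, ∀ F : Finset G, F.card ≤ s → ¬ Covers (↑F : Set G) (deltaSet G (a j)))
    {y : ℕ → ℕ} (h : 0 < k → OrderedBound G a y) (hy : ∀ v, r + 1 < v → y v = 0)
    (hys : 1 + k * y 1 ≤ s) :
    OrderedBound G a fun v => if v ≤ r then 1 + k * y (v + 1) else 0 := by
  intro p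
  set w : Fin (m + 1) → Fin (m + 1) → ℕ := fun q =>
    if (p q : ℕ) ≤ r then Pi.single q 1 else fun i => if (p i : ℕ) ≤ r then y (p i + 1) else 0
    with hw
  have hbound : ∀ q ∈ Finset.univ, TranslateBound G a (a q) (w q) := by
    intro q _
    by_cases hq : (p q : ℕ) ≤ r
    · simpa [hw, hq] using TranslateBound.self q
    · have hk : 0 < k := by have := (p q).isLt; omega
      have := h hk (p.trans (Fin.cycleRange (p q)))
      have hsymm : (p.trans (Fin.cycleRange (p q))).symm 0 = q := by
        rw [Equiv.symm_apply_eq]; simp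
      rw [hsymm] at this
      refine this.mono le_rfl fun i => ?_
      simp only [hw, hq, if_false]
      rcases lt_trichotomy (p i) (p q) with hlt | heq | hgt
      · have hval : (((p.trans (Fin.cycleRange (p q))) i : Fin (m + 1)) : ℕ) = p i + 1 :=
          Fin.coe_cycleRange_of_lt hlt
        have hne : (p.trans (Fin.cycleRange (p q))) i ≠ 0 := fun h0 => by
          rw [h0] at hval; simp at hval
        rw [if_neg hne, hval]
        split_ifs with h1
        · exact le_rfl
        · exact (hy _ (by omega)).le
      · have h0 : (p.trans (Fin.cycleRange (p q))) i = 0 := by simp [heq]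
        rw [if_pos h0]
        exact Nat.zero_le _
      · have he : (p.trans (Fin.cycleRange (p q))) i = p i := Fin.cycleRange_of_gt hgt
        have hlt : r + 1 < (p i : ℕ) := by have : (p q : ℕ) < p i := hgt; omega
        rw [he, hy _ hlt]
        simp
  have hcover := TranslateBound.finset_sup Finset.univ a w hbound
  rw [htop] at hcover
  have hcard : (Finset.univ.filter fun q => ¬ (p q : ℕ) ≤ r).card = k := by
    have h1 : (Finset.univ.filter fun q => ¬ (p q : ℕ) ≤ r).card
        = (Finset.univ.filter fun v : Fin (m + 1) => ¬ (v : ℕ) ≤ r).card := by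
      refine Finset.card_equiv p fun q => by simp
    have h2 : (Finset.univ.filter fun v : Fin (m + 1) => ¬ (v : ℕ) ≤ r)
        = Finset.Ioi (⟨r, by omega⟩ : Fin (m + 1)) := by
      ext v; simp [Fin.lt_def]
    rw [h1, h2, Fin.card_Ioi]
    simp; omega
  have hsum : ∀ i, (∑ q, w q) i = if (p i : ℕ) ≤ r then 1 + k * y (p i + 1) else 0 := by
    intro i
    rw [Finset.sum_apply,
      ← Finset.sum_filter_add_sum_filter_not Finset.univ fun q => (p q : ℕ) ≤ r]
    have e1 : ∑ q with (p q : ℕ) ≤ r, w q i = if (p i : ℕ) ≤ r then 1 else 0 := by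
      rw [Finset.sum_congr rfl (g := fun q => if i = q then 1 else 0)
        (fun q hq => by simp [hw, (Finset.mem_filter.1 hq).2, Pi.single_apply])]
      simp
    have e2 : ∑ q with ¬ (p q : ℕ) ≤ r, w q i
        = k * if (p i : ℕ) ≤ r then y (p i + 1) else 0 := by
      rw [Finset.sum_congr rfl (g := fun _ => if (p i : ℕ) ≤ r then y (p i + 1) else 0)
        (fun q hq => by simp only [hw, (Finset.mem_filter.1 hq).2, if_false])]
      rw [Finset.sum_const, hcard, smul_eq_mul]
    rw [e1, e2]
    split_ifs <;> simp
  have hl : (∑ q, w q) (p.symm 0) ≤ s := by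
    rw [hsum]; simpa using hys
  refine (hcover.eliminate hsup hinf h0dist (hs _) hl).mono le_rfl fun i => ?_
  by_cases hi : i = p.symm 0
  · subst hi; simp
  · have hi0 : p i ≠ 0 := fun h0 => hi (by rw [Equiv.eq_symm_apply, h0])
    simp [hi, hi0, hsum]

theorem one_add_mul_geom (k j : ℕ) :
    1 + k * ∑ p ∈ Finset.range j, k ^ p = ∑ p ∈ Finset.range (j + 1), k ^ p := by
  rw [Finset.sum_range_succ', Finset.mul_sum, add_comm]
  simp [pow_succ']

theorem OrderedBound.geom (hsup : ∀ (g : G) (x y : X), g • (x ⊔ y) = g • x ⊔ g • y)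
    (hinf : ∀ (g : G) (x y : X), g • (x ⊓ y) = g • x ⊓ g • y)
    (h0dist : ∀ x y z : X, x ⊓ y = ⊥ → x ⊓ (y ⊔ z) = x ⊓ z)
    {s m : ℕ} {a : Fin (m + 1) → X} (htop : Finset.univ.sup a = ⊤)
    (hs : ∀ j, ∀ F : Finset G, F.card ≤ s → ¬ Covers (↑F : Set G) (deltaSet G (a j)))
    (hgeom : ∀ k, 1 ≤ k → k ≤ m + 1 → ∑ p ∈ Finset.range (m + 2 - k), k ^ p ≤ s)
    (k : ℕ) (hk : k ≤ m) :
    OrderedBound G a fun v => ∑ p ∈ Finset.range (m + 1 - k - v), k ^ p := by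
  induction k with
  | zero =>
    have hs1 : 1 ≤ s := by simpa using hgeom (m + 1) (by omega) le_rfl
    refine (OrderedBound.step hsup hinf h0dist (zero_add m) htop hs (y := 0)
      (fun h => absurd h (lt_irrefl 0)) (fun _ _ => rfl) (by simpa using hs1)).mono fun v _ => ?_
    split_ifs with hv
    · obtain ⟨j, hj⟩ : ∃ j, m + 1 - 0 - v = j + 1 := ⟨m - v, by omega⟩
      rw [hj, ← one_add_mul_geom]; simp
    · exact Nat.zero_le _
  | succ k ih =>
    have key : ∀ t, OrderedBound G a fun v =>
        if m - k + 1 ≤ v + t then ∑ p ∈ Finset.range (m - k - v), (k + 1) ^ p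
        else ∑ p ∈ Finset.range (m - k + 1 - v), (k + 1) ^ p := by
      intro t
      induction t with
      | zero =>
        refine (ih (by omega)).mono fun v _ => ?_
        have hle : ∑ p ∈ Finset.range (m + 1 - k - v), k ^ p
            ≤ ∑ p ∈ Finset.range (m - k + 1 - v), (k + 1) ^ p := by
          rw [show m + 1 - k - v = m - k + 1 - v by omega]
          exact Finset.sum_le_sum fun p _ => Nat.pow_le_pow_left (Nat.le_succ k) p
        split_ifs with hv
        · rw [show m + 1 - k - v = 0 by omega]; simp
        · exact hle
      | succ t iht =>
        refine (OrderedBound.step hsup hinf h0dist (k := k + 1) (r := m - (k + 1)) (by omega)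
          htop hs (fun _ => iht) (fun v hv => ?_) ?_).mono fun v _ => ?_
        · rw [show m - k - v = 0 by omega, show m - k + 1 - v = 0 by omega]; simp
        · have hle := hgeom (k + 1) (by omega) (by omega)
          rw [show m + 2 - (k + 1) = m - k + 1 by omega, ← one_add_mul_geom] at hle
          refine le_trans (Nat.add_le_add_left (Nat.mul_le_mul_left _ ?_) 1) hle
          split_ifs
          · exact Finset.sum_le_sum_of_subset (Finset.range_mono (by omega))
          · exact le_rfl
        · split_ifs with h1 h2 h3 h3
          · rw [one_add_mul_geom, show m - k - (v + 1) + 1 = m - k - v by omega]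
          · omega
          · omega
          · rw [one_add_mul_geom, show m - k + 1 - (v + 1) + 1 = m - k + 1 - v by omega]
          · exact Nat.zero_le _
          · exact Nat.zero_le _
    refine (key (m + 1)).mono fun v _ => ?_
    rw [if_pos (by omega), show m + 1 - (k + 1) - v = m - k - v by omega]

theorem exists_covers_deltaSet (hbt : (⊥ : X) ≠ ⊤)
    (hsup : ∀ (g : G) (x y : X), g • (x ⊔ y) = g • x ⊔ g • y)
    (hinf : ∀ (g : G) (x y : X), g • (x ⊓ y) = g • x ⊓ g • y)
    (h0dist : ∀ x y z : X, x ⊓ y = ⊥ → x ⊓ (y ⊔ z) = x ⊓ z)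
    {s m : ℕ} {a : Fin (m + 1) → X} (htop : Finset.univ.sup a = ⊤)
    (hgeom : ∀ k, 1 ≤ k → k ≤ m + 1 → ∑ p ∈ Finset.range (m + 2 - k), k ^ p ≤ s) :
    ∃ j, ∃ F : Finset G, F.card ≤ s ∧ Covers (↑F : Set G) (deltaSet G (a j)) := by
  by_contra! hs
  have h := OrderedBound.geom hsup hinf h0dist htop hs hgeom m le_rfl
  refine hbt ?_
  rw [← htop, eq_comm, Finset.sup_eq_bot_iff]
  intro j _
  have hj := h (Equiv.swap j 0)
  rw [Equiv.symm_swap, Equiv.swap_apply_right] at hj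
  refine hj.eq_bot fun i => ?_
  split_ifs with h0
  · rfl
  · have : (Equiv.swap j 0 i : ℕ) ≠ 0 := fun h1 => h0 (Fin.ext h1)
    beta_reduce
    rw [show m + 1 - m - (Equiv.swap j 0 i : ℕ) = 0 by omega]; simp

theorem inv_le_protasov {s : ℕ} {x : X} {F : Finset G} (hF : F.card ≤ s)
    (hcov : Covers (↑F : Set G) (deltaSet G x)) : 1 / (s : ℝ) ≤ protasov G x := by
  have hle : covNum G (deltaSet G x) ≤ F.card := sInf_le ⟨F, rfl, hcov⟩
  have hlt : covNum G (deltaSet G x) < ⊤ := hle.trans_lt (WithTop.coe_lt_top _)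
  have hpos : 0 < covNum G (deltaSet G x) := by
    refine zero_lt_one.trans_le (le_sInf ?_)
    rintro c ⟨E, rfl, hE⟩
    obtain ⟨f, hf, -⟩ := hE 1
    exact_mod_cast Finset.card_pos.2 ⟨f, hf⟩
  rw [protasov, if_pos ⟨hpos, hlt⟩]
  lift covNum G (deltaSet G x) to ℕ using hlt.ne with c hc
  have hc0 : 0 < c := by exact_mod_cast hpos
  have hcF : c ≤ F.card := by exact_mod_cast hle
  rw [ENat.toNat_natCast]
  exact one_div_le_one_div_of_le (by exact_mod_cast hc0) (by exact_mod_cast hcF.trans hF)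

theorem protasov_nonneg (x : X) : 0 ≤ protasov G x := by
  unfold protasov
  split_ifs <;> positivity

end Bounds

theorem bddAbove_phiR (m : ℕ) :
    BddAbove ((fun x : ℝ => (x ^ ((m : ℝ) - x) - 1) / (x - 1)) '' Set.Ioo 1 (m : ℝ)) := by
  refine ⟨∑ i ∈ Finset.range m, (m : ℝ) ^ i, ?_⟩
  rintro _ ⟨x, ⟨h1, h2⟩, rfl⟩
  have hx : 0 < x - 1 := sub_pos.2 h1
  calc (x ^ ((m : ℝ) - x) - 1) / (x - 1) ≤ (x ^ m - 1) / (x - 1) := by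
        gcongr
        rw [← Real.rpow_natCast]
        exact Real.rpow_le_rpow_of_exponent_le h1.le (by linarith)
    _ = ∑ i ∈ Finset.range m, x ^ i := (geom_sum_eq h1.ne' m).symm
    _ ≤ _ := by gcongr

theorem natCast_le_phiR {n : ℕ} (hn : 1 ≤ n) : (n : ℝ) ≤ phiR (n + 1) := by
  have hd : HasDerivAt (fun x : ℝ => x ^ (((n + 1 : ℕ) : ℝ) - x)) n 1 := by
    have := (hasDerivAt_id (1 : ℝ)).rpow
      ((hasDerivAt_const (1 : ℝ) (((n + 1 : ℕ) : ℝ))).sub (hasDerivAt_id (1 : ℝ))) (by simp)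
    simpa using this
  have ht := (hasDerivAt_iff_tendsto_slope.1 hd).mono_left
    (nhdsWithin_mono (1 : ℝ) (fun x (hx : x ∈ Set.Ioi 1) => ne_of_gt hx))
  refine le_of_tendsto ht ?_
  have hlt : (1 : ℝ) < ((n + 1 : ℕ) : ℝ) := by exact_mod_cast Nat.lt_succ_of_le hn
  filter_upwards [Ioo_mem_nhdsGT hlt] with x hx
  refine le_csSup (bddAbove_phiR (n + 1)) ⟨x, hx, ?_⟩
  simp [slope_def_field]

theorem geom_sum_le_phiR {n k : ℕ} (hk : 1 ≤ k) (hkn : k ≤ n) :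
    ((∑ p ∈ Finset.range (n + 1 - k), k ^ p : ℕ) : ℝ) ≤ phiR (n + 1) := by
  rcases hk.eq_or_lt with rfl | hk1
  · simpa using natCast_le_phiR hkn
  · have hk1' : (1 : ℝ) < k := by exact_mod_cast hk1
    refine le_csSup (bddAbove_phiR (n + 1)) ⟨k, ⟨hk1', by exact_mod_cast Nat.lt_succ_of_le hkn⟩, ?_⟩
    have : ((n + 1 : ℕ) : ℝ) - k = ((n + 1 - k : ℕ) : ℝ) := by
      rw [Nat.cast_sub (by omega)]
    push_cast [this]
    simp only [← Nat.cast_add_one, this, Real.rpow_natCast]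
    rw [geom_sum_eq hk1'.ne']

/-- For any `0`-distributive bounded `G`-lattice `X` and `n ≥ 1`, the `n`-th
subadditivity defect of the Protasov density at `⊤` is at most `1 - 1/φ(n+1)`:
for every finite `A ⊆ X` with `|A| ≤ n` and `⋁A = ⊤` one has
`Σ_{a ∈ A} p_X(a) ≥ 1/φ(n+1)`. -/
theorem defect_upper_bound
    {G : Type*} [Group G] {X : Type*} [Lattice X] [BoundedOrder X] [MulAction G X]
    (hbt : (⊥ : X) ≠ ⊤)
    (hsup : ∀ (g : G) (x y : X), g • (x ⊔ y) = g • x ⊔ g • y)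
    (hinf : ∀ (g : G) (x y : X), g • (x ⊓ y) = g • x ⊓ g • y)
    (h0dist : ∀ x y z : X, x ⊓ y = ⊥ → x ⊓ (y ⊔ z) = x ⊓ z)
    (n : ℕ) (hn : 1 ≤ n) (A : Finset X) (hcard : A.card ≤ n) (hA : A.sup id = ⊤) :
    1 / phiR (n + 1) ≤ ∑ a ∈ A, protasov G a := by
  classical
  have hphi : 1 ≤ phiR (n + 1) := le_trans (by exact_mod_cast hn) (natCast_le_phiR hn)
  obtain ⟨m, hm⟩ : ∃ m, A.card = m + 1 := by
    refine Nat.exists_eq_succ_of_ne_zero fun h0 => hbt ?_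
    rw [Finset.card_eq_zero.1 h0] at hA
    simpa using hA
  set e := A.equivFinOfCardEq hm
  have htop : Finset.univ.sup (fun j => (e.symm j : X)) = ⊤ := by
    rw [← top_le_iff, ← hA]
    refine Finset.sup_le fun x hx => ?_
    have := Finset.le_sup (f := fun j => (e.symm j : X)) (Finset.mem_univ (e ⟨x, hx⟩))
    simpa using this
  obtain ⟨j, F, hF, hcov⟩ := exists_covers_deltaSet (s := ⌊phiR (n + 1)⌋₊) hbt hsup hinf h0dist
    htop fun k hk hkm => by
      refine le_trans (Finset.sum_le_sum_of_subset (Finset.range_mono ?_))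
        (Nat.le_floor (geom_sum_le_phiR hk (show k ≤ n by omega)))
      omega
  have hs : 0 < ⌊phiR (n + 1)⌋₊ := Nat.floor_pos.2 hphi
  calc 1 / phiR (n + 1) ≤ 1 / (⌊phiR (n + 1)⌋₊ : ℝ) :=
        one_div_le_one_div_of_le (by exact_mod_cast hs) (Nat.floor_le (by linarith))
    _ ≤ protasov G (e.symm j : X) := inv_le_protasov hF hcov
    _ ≤ ∑ a ∈ A, protasov G a :=
        Finset.single_le_sum (f := fun a => protasov G a) (fun a _ => protasov_nonneg a)
          (e.symm j).2
end

section
/- For every integer n ≥ 51 and the real number w > 0 with w·exp(w) = n·e: n·w − 2n + n/w + w/n < ln(φ(n+1)) < n·w − 2n + n/w + w/n + ln(ln(n·e))/n. -/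
open Real

/-- The exponent `(n - x) log x` drops at least quadratically to the left of its maximum point
`exp (w - 1)`, where `n = w * exp (w - 1)`. -/
theorem sub_mul_log_le_of_le_one {w s : ℝ} (hw : 1 ≤ w) (hs : 0 < s) (hs1 : s ≤ 1) :
    (w * exp (w - 1) - exp (w - 1) * s) * log (exp (w - 1) * s) ≤
      exp (w - 1) * (w - 1) ^ 2 - exp (w - 1) * ((w + 1) / 2 * (1 - s) ^ 2) := by
  rw [log_mul (exp_pos _).ne' hs.ne', log_exp]
  have hlog : log s ≤ -(1 - s) - (1 - s) ^ 2 / 2 := by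
    have h := sum_le_hasSum (Finset.range 2) (fun i _ => by
        have : 0 ≤ 1 - s := by linarith
        positivity)
      (hasSum_pow_div_log_of_abs_lt_one
        (abs_lt.2 ⟨by linarith, by linarith⟩ : |1 - s| < 1))
    norm_num [Finset.sum_range_succ] at h
    linarith
  have hX := exp_pos (w - 1)
  have key : (w - s) * (w - 1 + log s) ≤ (w - 1) ^ 2 - (w + 1) / 2 * (1 - s) ^ 2 := by
    nlinarith [mul_nonneg (sub_nonneg.2 (hs1.trans hw)) (sub_nonneg.2 hlog),
      mul_nonneg (mul_nonneg (sub_nonneg.2 hs1) (sub_nonneg.2 hs1)) (sub_nonneg.2 hs1)]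
  nlinarith [mul_le_mul_of_nonneg_left key hX.le]

/-- The exponent `(n - x) log x` is maximal at `exp (w - 1)`, where `n = w * exp (w - 1)`. -/
theorem sub_mul_log_le {w s : ℝ} (hw : 1 ≤ w) (hs : 0 < s) :
    (w * exp (w - 1) - exp (w - 1) * s) * log (exp (w - 1) * s) ≤
      exp (w - 1) * (w - 1) ^ 2 := by
  rw [log_mul (exp_pos _).ne' hs.ne', log_exp]
  have hX := exp_pos (w - 1)
  have h1 : log s ≤ s - 1 := log_le_sub_one_of_pos hs
  have h2 : (1 - s) * log s ≤ 0 := by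
    rcases le_total s 1 with h | h
    · exact mul_nonpos_of_nonneg_of_nonpos (by linarith) (log_nonpos hs.le h)
    · exact mul_nonpos_of_nonpos_of_nonneg (by linarith) (log_nonneg h)
  have key : (w - s) * (w - 1 + log s) ≤ (w - 1) ^ 2 := by
    nlinarith [mul_nonneg (sub_nonneg.2 hw) (sub_nonneg.2 h1)]
  nlinarith [mul_le_mul_of_nonneg_left key hX.le]

/-- A bound for the quotient defining `phiR`, sharp for `x` far from `1`. -/
theorem quotient_le_exp_add_inv {x m : ℝ} (hx : 1 < x) :
    (x ^ (m + 1 - x) - 1) / (x - 1) ≤ exp ((m - x) * log x + 1 / (x - 1)) := by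
  have hx0 : 0 < x := by linarith
  have hx1 : 0 < x - 1 := by linarith
  have h : x ^ (m + 1 - x) = exp ((m - x) * log x) * x := by
    rw [rpow_def_of_pos hx0, show log x * (m + 1 - x) = (m - x) * log x + log x by ring,
      exp_add, exp_log hx0]
  rw [h, exp_add, div_le_iff₀ hx1]
  have h1 : x ≤ exp (1 / (x - 1)) * (x - 1) := by
    have := mul_le_mul_of_nonneg_right (add_one_le_exp (1 / (x - 1))) hx1.le
    rwa [add_mul, one_div_mul_cancel hx1.ne', show 1 + 1 * (x - 1) = x by ring] at this
  nlinarith [mul_le_mul_of_nonneg_left h1 (exp_pos ((m - x) * log x)).le]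

/-- A bound for the quotient defining `phiR`, useful for `x` close to `1`. -/
theorem quotient_le_mul_exp {x m : ℝ} (hx : 1 < x) (hxm : x < m) :
    (x ^ (m + 1 - x) - 1) / (x - 1) ≤ m * exp ((m - x) * log x) := by
  have hx0 : 0 < x := by linarith
  have hx1 : 0 < x - 1 := by linarith
  have h : x ^ (m + 1 - x) = exp ((m - x) * log x) * x := by
    rw [rpow_def_of_pos hx0, show log x * (m + 1 - x) = (m - x) * log x + log x by ring,
      exp_add, exp_log hx0]
  have hE := exp_pos ((m - x) * log x)
  have hlog : log x ≤ x - 1 := log_le_sub_one_of_pos hx0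
  have h1 : exp ((m - x) * log x) * (1 - (m - x) * log x) ≤ 1 := by
    have := mul_le_mul_of_nonneg_left (one_sub_le_exp_neg ((m - x) * log x)) hE.le
    rwa [← exp_add, add_neg_cancel, exp_zero] at this
  rw [h, div_le_iff₀ hx1]
  nlinarith [mul_le_mul_of_nonneg_left
    (mul_le_mul_of_nonneg_left hlog (by linarith : 0 ≤ m - x)) hE.le,
    mul_nonneg hE.le (mul_nonneg hx1.le hx1.le)]

theorem seven_halves_lt_of_lambert {w : ℝ} (hn : 51 ≤ w * exp (w - 1)) : 7 / 2 < w := by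
  by_contra! h
  have h2 : exp (5 / 2) ^ 2 = exp 1 ^ 5 := by
    rw [← exp_nat_mul, ← exp_nat_mul]; norm_num
  have h3 : exp 1 ^ 5 ≤ 2.7182818286 ^ 5 :=
    pow_le_pow_left₀ (exp_pos _).le exp_one_lt_d9.le 5
  have h4 : exp (5 / 2) ≤ 13 := by
    nlinarith [exp_pos (5 / 2)]
  have h5 : exp (w - 1) ≤ exp (5 / 2) := exp_le_exp.2 (by linarith)
  nlinarith [exp_pos (w - 1)]

theorem twelve_mul_le_exp {w : ℝ} : 12 * (w - 5 / 2) ≤ exp (w - 1) := by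
  have h2 : exp (5 / 2) ^ 2 = exp 1 ^ 5 := by
    rw [← exp_nat_mul, ← exp_nat_mul]; norm_num
  have h3 : 2.7182818283 ^ 5 ≤ exp 1 ^ 5 :=
    pow_le_pow_left₀ (by norm_num) exp_one_gt_d9.le 5
  have h4 : 12 ≤ exp (5 / 2) := by
    nlinarith [exp_pos (5 / 2)]
  have h5 : exp (w - 1) = exp (5 / 2) * exp (w - 7 / 2) := by
    rw [← exp_add]; ring_nf
  have h6 := add_one_le_exp (w - 7 / 2)
  nlinarith [exp_pos (w - 7 / 2)]

theorem quotient_le_exp {w x : ℝ} (hw : 7 / 2 < w) (hx : 1 < x) :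
    (x ^ (w * exp (w - 1) + 1 - x) - 1) / (x - 1) ≤
      exp (exp (w - 1) * (w - 1) ^ 2 + 1 / exp (w - 1) + 1 / (w * exp (w - 1))) := by
  have hX12 := twelve_mul_le_exp (w := w)
  obtain ⟨s, rfl⟩ : ∃ s, x = exp (w - 1) * s :=
    ⟨x / exp (w - 1), by field_simp⟩
  have hs : 0 < s := pos_of_mul_pos_right (by linarith : 0 < exp (w - 1) * s) (exp_pos _).le
  have hmax := sub_mul_log_le (by linarith : 1 ≤ w) hs
  have hquad := sub_mul_log_le_of_le_one (by linarith : 1 ≤ w) hs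
  have hX := exp_pos (w - 1)
  have hlogX : log (exp (w - 1)) = w - 1 := log_exp _
  have h_first := quotient_le_exp_add_inv (m := w * exp (w - 1)) hx
  have h_second := quotient_le_mul_exp (m := w * exp (w - 1)) hx
  generalize exp (w - 1) = X at *
  have hw0 : 0 < w := by linarith
  have hXw : 0 < w * X := by positivity
  rcases le_or_gt 1 s with h1 | h1
  · refine h_first.trans (exp_le_exp.2 ?_)
    have : 1 / (X * s - 1) ≤ 1 / X + 1 / (w * X) := by
      rw [div_add_div _ _ hX.ne' hXw.ne', div_le_div_iff₀ (by linarith) (by positivity)]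
      have : X * (w * X) ≤ (w * X + X) * (X - 1) := by nlinarith
      nlinarith [mul_le_mul_of_nonneg_left h1 hX.le]
    linarith
  have hquad := hquad h1.le
  rcases le_or_gt 2 (X * s) with h2 | h2
  · refine h_first.trans (exp_le_exp.2 ?_)
    have : 1 / (X * s - 1) ≤ X * ((w + 1) / 2 * (1 - s) ^ 2) + 1 / X + 1 / (w * X) := by
      rcases le_or_gt s (1 / 2) with h3 | h3
      · have h4 : 1 / (X * s - 1) ≤ 1 := by
          rw [div_le_one (by linarith)]; linarith
        have h5 : 1 ≤ X * ((w + 1) / 2 * (1 - s) ^ 2) := by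
          have : 1 / 4 ≤ (1 - s) ^ 2 := by nlinarith
          have : 1 / 2 ≤ (w + 1) / 2 * (1 - s) ^ 2 := by nlinarith
          nlinarith
        have : 0 < 1 / X + 1 / (w * X) := by positivity
        linarith
      · have h4 : 1 / (X * s - 1) ≤ (1 + 12 / 5 * (1 - s + 1 / X)) / X := by
          rw [div_le_div_iff₀ (by linarith) hX]
          have e : (1 + 12 / 5 * (1 - s + 1 / X)) * (X * s - 1) - 1 * X =
            X * (1 - s + 1 / X) * (12 / 5 * (s - 1 / X) - 1) := by field_simp; ring
          have h5 : 1 / X ≤ 1 / 12 := by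
            apply one_div_le_one_div_of_le <;> linarith
          have : 0 ≤ X * (1 - s + 1 / X) * (12 / 5 * (s - 1 / X) - 1) := by
            apply mul_nonneg
            · have : 0 < 1 / X := by positivity
              apply mul_nonneg hX.le; linarith
            · linarith
          linarith
        refine h4.trans ?_
        rw [div_le_iff₀ hX]
        have e : (X * ((w + 1) / 2 * (1 - s) ^ 2) + 1 / X + 1 / (w * X)) * X =
          X ^ 2 * ((w + 1) / 2 * (1 - s) ^ 2) + 1 + 1 / w := by field_simp
        rw [e]
        have h5 : 1 / X ≤ 1 / (3 * w) := by
          apply one_div_le_one_div_of_le <;> linarith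
        have h6 : 1 / (3 * w) = 1 / 3 * (1 / w) := by field_simp
        have h7 : 1 / w * w = 1 := by field_simp
        have h8 : 0 < 1 / w := by positivity
        have h9 : 72 * w * (1 - s) ^ 2 ≤ X ^ 2 * ((w + 1) / 2 * (1 - s) ^ 2) := by
          have : 144 ≤ X ^ 2 := by nlinarith
          have : 0 ≤ (w + 1) / 2 * (1 - s) ^ 2 := by positivity
          nlinarith [sq_nonneg (1 - s)]
        have h10 : 12 / 5 * (1 - s) ≤ 72 * w * (1 - s) ^ 2 + 1 / 50 * (1 / w) := by
          have h11 : 72 * w * (1 - s) ^ 2 + 1 / 50 * (1 / w) - 12 / 5 * (1 - s) =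
            1 / w * (72 * (w * (1 - s)) ^ 2 + 1 / 50 - 12 / 5 * (w * (1 - s))) := by
            field_simp
          have := mul_nonneg h8.le (by nlinarith [sq_nonneg (w * (1 - s) - 1 / 60)] :
            0 ≤ 72 * (w * (1 - s)) ^ 2 + 1 / 50 - 12 / 5 * (w * (1 - s)))
          linarith
        linarith
    linarith
  · have hs6 : s ≤ 1 / 6 := by nlinarith
    refine (h_second (by nlinarith)).trans ?_
    rw [← exp_log hXw, ← exp_add, exp_log hXw]
    refine exp_le_exp.2 ?_
    rw [log_mul hw0.ne' hX.ne', hlogX]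
    have h3 : log w ≤ w - 1 := log_le_sub_one_of_pos hw0
    have h4 : 25 / 36 ≤ (1 - s) ^ 2 := by nlinarith
    have h5 : 25 / 72 * (w + 1) ≤ (w + 1) / 2 * (1 - s) ^ 2 := by nlinarith
    have h6 : 4 * (w + 1) ≤ X * ((w + 1) / 2 * (1 - s) ^ 2) := by nlinarith
    have : 0 < 1 / X + 1 / (w * X) := by positivity
    linarith

theorem exp_lt_quotient {w : ℝ} (hw : 7 / 2 < w) :
    exp (exp (w - 1) * (w - 1) ^ 2 + 1 / exp (w - 1)) <
      (exp (w - 1) ^ (w * exp (w - 1) + 1 - exp (w - 1)) - 1) / (exp (w - 1) - 1) := by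
  have hX12 := twelve_mul_le_exp (w := w)
  have h : exp (w - 1) ^ (w * exp (w - 1) + 1 - exp (w - 1)) =
      exp (exp (w - 1) * (w - 1) ^ 2) * exp (w - 1) := by
    rw [← exp_mul, ← exp_add]; ring_nf
  rw [h, exp_add]
  generalize exp (w - 1) = X at *
  have hX : 12 < X := by linarith
  have hX0 : 0 < X := by linarith
  rw [lt_div_iff₀ (by linarith)]
  have hF : 4 * X < exp (X * (w - 1) ^ 2) := by
    have := add_one_le_exp (X * (w - 1) ^ 2)
    have : 4 ≤ (w - 1) ^ 2 := by nlinarith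
    nlinarith
  have hc : exp (1 / X) ≤ 1 + 1 / X + (1 / X) ^ 2 / 2 + 2 / 9 * (1 / X) ^ 3 := by
    have := exp_bound' (x := 1 / X) (by positivity)
      (by rw [div_le_one hX0]; linarith) (n := 3) (by norm_num)
    norm_num [Finset.sum_range_succ, Nat.factorial] at this ⊢
    linarith
  have h1 : exp (1 / X) * (X - 1) ≤ X - 1 / (4 * X) := by
    refine (mul_le_mul_of_nonneg_right hc (by linarith)).trans ?_
    have e : X - 1 / (4 * X) - (1 + 1 / X + (1 / X) ^ 2 / 2 + 2 / 9 * (1 / X) ^ 3) * (X - 1) =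
      (1 / X) * (1 / 4 + 5 / 18 * (1 / X) + 2 / 9 * (1 / X) ^ 2) := by field_simp; ring
    have : 0 < (1 / X) * (1 / 4 + 5 / 18 * (1 / X) + 2 / 9 * (1 / X) ^ 2) := by positivity
    linarith
  have h2 : 1 < exp (X * (w - 1) ^ 2) * (1 / (4 * X)) := by
    rw [mul_one_div, lt_div_iff₀ (by linarith)]; linarith
  nlinarith [mul_le_mul_of_nonneg_left h1 (exp_pos (X * (w - 1) ^ 2)).le]

/-- For `n ≥ 51`, with `w = W(n e)` the Lambert W-function value at `n e`:
`n w - 2n + n/w + w/n < ln φ(n+1) < n w - 2n + n/w + w/n + ln ln (n e) / n`. -/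
theorem bound_phi (n : ℕ) (hn : 51 ≤ n) (w : ℝ) (hw : 0 < w)
    (hwe : w * Real.exp w = n * Real.exp 1) :
    n * w - 2 * n + n / w + w / n < Real.log (phiR (n + 1)) ∧
    Real.log (phiR (n + 1)) <
      n * w - 2 * n + n / w + w / n + Real.log (Real.log (n * Real.exp 1)) / n := by
  have hnw : (n : ℝ) = w * exp (w - 1) := by
    rw [exp_sub, ← mul_div_assoc, hwe]; field_simp
  have hn' : (51 : ℝ) ≤ w * exp (w - 1) := by rw [← hnw]; exact_mod_cast hn
  have hw' := seven_halves_lt_of_lambert hn'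
  have hX12 := twelve_mul_le_exp (w := w)
  have hX := exp_pos (w - 1)
  have hL : 1 < log (log (n * exp 1)) := by
    rw [← hwe, log_mul hw.ne' (exp_pos _).ne', log_exp, lt_log_iff_exp_lt]
    · linarith [exp_one_lt_d9, log_nonneg (by linarith : 1 ≤ w)]
    · linarith [log_nonneg (by linarith : 1 ≤ w)]
  have hmain : n * w - 2 * n + n / w + w / n =
      exp (w - 1) * (w - 1) ^ 2 + 1 / exp (w - 1) := by
    rw [hnw]; field_simp; ring
  have hub : ∀ y ∈ (fun x : ℝ => (x ^ (((n + 1 : ℕ) : ℝ) - x) - 1) / (x - 1)) ''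
      Set.Ioo 1 ((n + 1 : ℕ) : ℝ),
      y ≤ exp (exp (w - 1) * (w - 1) ^ 2 + 1 / exp (w - 1) + 1 / n) := by
    rintro _ ⟨x, hx, rfl⟩
    have := quotient_le_exp hw' hx.1
    rw [← hnw] at this
    simpa using this
  have hmem : exp (w - 1) ∈ Set.Ioo 1 ((n + 1 : ℕ) : ℝ) := by
    push_cast
    rw [hnw]
    constructor <;> nlinarith
  have hlow : exp (exp (w - 1) * (w - 1) ^ 2 + 1 / exp (w - 1)) < phiR (n + 1) := by
    have h := exp_lt_quotient hw'
    rw [← hnw] at h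
    refine h.trans_le (le_csSup ⟨_, hub⟩ ⟨_, hmem, ?_⟩)
    simp
  have hup : phiR (n + 1) ≤ exp (exp (w - 1) * (w - 1) ^ 2 + 1 / exp (w - 1) + 1 / n) :=
    csSup_le ⟨_, _, hmem, rfl⟩ hub
  have hpos : 0 < phiR (n + 1) := (exp_pos _).trans hlow
  rw [hmain]
  refine ⟨(lt_log_iff_exp_lt hpos).2 hlow, ((log_le_iff_le_exp hpos).2 hup).trans_lt ?_⟩
  have : (0 : ℝ) < n := by rw [hnw]; positivity
  gcongr
end

section
/- For every integer n ≥ 2 the following chain of inequalities holds: varphi(n) ≤ φ(n) < s₋∞(n) ≤ varphi(n+1) ≤ φ(n+1), where the real number φ(n) is compared with s₋∞(n) ∈ ℕ∞ via coercion; in particular s₋∞(n) is finite. -/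
/-- The indicator function `1_i : Fin n → ℕ` of `{i}`. -/
def oneAt {n : ℕ} (i : Fin n) : Fin n → ℕ := fun j => if j = i then 1 else 0

/-- Pointwise sumset `Σ_{j ∈ Fin n} A j` of a family of sets of functions. -/
def sumset {n : ℕ} (A : Fin n → Set (Fin n → ℕ)) : Set (Fin n → ℕ) :=
  {x | ∃ a : Fin n → Fin n → ℕ, (∀ j, a j ∈ A j) ∧ x = ∑ j, a j}

/-- The strict lower cone `↓ℏ`. -/
def lowerCone {n : ℕ} (h : Fin n → ℕ) : Set (Fin n → ℕ) :=
  {g | ∀ i, g i < h i}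

/-- One step of the generation process: `{x - x(i)·1_i : x ∈ ↓ℏ ∩ Σ_j B j}`. -/
def genStep {n : ℕ} (h : Fin n → ℕ) (B : Fin n → Set (Fin n → ℕ)) (i : Fin n) :
    Set (Fin n → ℕ) :=
  {y | ∃ x ∈ lowerCone h ∩ sumset B, y = x - x i • oneAt i}

/-- The sets `ℏ^{[m]}(i)`. -/
def bracketSet {n : ℕ} (h : Fin n → ℕ) : ℕ → Fin n → Set (Fin n → ℕ)
  | 0 => fun i => {oneAt i}
  | m + 1 => fun i => genStep h (bracketSet h m) i ∪ bracketSet h m i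

/-- The sets `ℏ^{⦃m⦄}(i)`. -/
def braceSet {n : ℕ} (h : Fin n → ℕ) : ℕ → Fin n → Set (Fin n → ℕ)
  | 0 => fun i => {oneAt i}
  | m + 1 => genStep h (bracketSet h m)

/-- `ℏ` is `0`-generating if the zero function belongs to `⋃_{i} ⋃_{m} ℏ^{⦃m⦄}(i)`. -/
def IsZeroGenerating {n : ℕ} (h : Fin n → ℕ) : Prop :=
  ∃ i : Fin n, ∃ m : ℕ, (0 : Fin n → ℕ) ∈ braceSet h m i

/-- `s₋∞(n)`: the supremum of `min_i ℏ(i)` over non-`0`-generating `ℏ : Fin n → ℕ`. -/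
noncomputable def sMinusInfty (n : ℕ) : ℕ∞ :=
  ⨆ (h : Fin n → ℕ) (_ : ¬ IsZeroGenerating h), ⨅ i, (h i : ℕ∞)

/-- `varphi(m) = max_{0 < k < m} Σ_{i=0}^{m-k-1} k^i` (with `varphi(1) = 0`). -/
def varphiN (m : ℕ) : ℕ :=
  (Finset.Ioo 0 m).sup fun k => ∑ i ∈ Finset.range (m - k), k ^ i

/-- The point `i` is generated (at some stage) below the bound `b`. -/
def ReachesBelow {n : ℕ} (h : Fin n → ℕ) (i : Fin n) (b : Fin n → ℕ) : Prop :=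
  ∃ m, ∃ y ∈ bracketSet h m i, y ≤ b

theorem bracketSet_mono {n : ℕ} (h : Fin n → ℕ) (i : Fin n) :
    Monotone fun m => bracketSet h m i :=
  monotone_nat_of_le_succ fun _ => Set.subset_union_right

theorem exists_braceSet_of_mem_bracketSet {n : ℕ} {h : Fin n → ℕ} {i : Fin n} {y : Fin n → ℕ} :
    ∀ {m : ℕ}, y ∈ bracketSet h m i → ∃ k, y ∈ braceSet h k i
  | 0, hy => ⟨0, hy⟩
  | m + 1, hy => hy.elim (fun hy => ⟨m + 1, hy⟩) exists_braceSet_of_mem_bracketSet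

theorem reachesBelow_oneAt {n : ℕ} (h : Fin n → ℕ) (i : Fin n) :
    ReachesBelow h i (oneAt i) :=
  ⟨0, oneAt i, rfl, le_rfl⟩

theorem ReachesBelow.mono {n : ℕ} {h : Fin n → ℕ} {i : Fin n} {b b' : Fin n → ℕ}
    (hb : ReachesBelow h i b) (hbb : b ≤ b') : ReachesBelow h i b' :=
  let ⟨m, y, hy, hyb⟩ := hb
  ⟨m, y, hy, hyb.trans hbb⟩

theorem reachesBelow_update_sum {n : ℕ} {h : Fin n → ℕ} {b : Fin n → Fin n → ℕ}
    (hb : ∀ j, ReachesBelow h j (b j)) (hlt : ∀ l, ∑ j, b j l < h l) (i : Fin n) :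
    ReachesBelow h i (Function.update (∑ j, b j) i 0) := by
  choose m y hy hyb using hb
  have hle : ∑ j, y j ≤ ∑ j, b j := Finset.sum_le_sum fun j _ => hyb j
  refine ⟨Finset.univ.sup m + 1, _, Or.inl ⟨∑ j, y j, ⟨fun l => ?_, y, fun j => ?_, rfl⟩, rfl⟩, ?_⟩
  · refine lt_of_le_of_lt (hle l) ?_
    simpa using hlt l
  · exact bracketSet_mono h j (Finset.le_sup (Finset.mem_univ j)) (hy j)
  · intro l
    by_cases hl : l = i
    · subst hl
      simp [oneAt]
    · have := hle l
      simp only [Function.update_of_ne hl]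
      exact (Nat.sub_le _ _).trans this

theorem isZeroGenerating_of_reachesBelow_zero {n : ℕ} {h : Fin n → ℕ} {i : Fin n}
    (hi : ReachesBelow h i 0) : IsZeroGenerating h := by
  obtain ⟨m, y, hy, hy0⟩ := hi
  obtain rfl : y = 0 := le_antisymm hy0 zero_le
  obtain ⟨k, hk⟩ := exists_braceSet_of_mem_bracketSet hy
  exact ⟨i, k, hk⟩

/-- Moving the point `i` to the first position. -/
theorem exists_perm_move_first {n : ℕ} (σ : Equiv.Perm (Fin n)) (i : Fin n) :
    ∃ τ : Equiv.Perm (Fin n), (τ i : ℕ) = 0 ∧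
      ∀ l, l ≠ i → (τ l : ℕ) = if (σ l : ℕ) < σ i then (σ l : ℕ) + 1 else σ l := by
  obtain ⟨n, rfl⟩ : ∃ k, n = k + 1 := ⟨n - 1, by have := i.2; omega⟩
  refine ⟨σ.trans (Fin.cycleRange (σ i)), by simp, fun l hl => ?_⟩
  have hne : σ l ≠ σ i := fun h => hl (σ.injective h)
  rcases lt_or_gt_of_ne hne with h | h
  · rw [Equiv.trans_apply, Fin.coe_cycleRange_of_lt h, if_pos (by exact h)]
  · rw [Equiv.trans_apply, Fin.cycleRange_of_gt h, if_neg (by have : (σ i : ℕ) < σ l := h; omega)]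

/-- Moving the point `i` to the last position. -/
theorem exists_perm_move_last {n : ℕ} (σ : Equiv.Perm (Fin n)) (i : Fin n) :
    ∃ τ : Equiv.Perm (Fin n),
      ∀ l, l ≠ i → (τ l : ℕ) = if (σ l : ℕ) < σ i then (σ l : ℕ) else σ l - 1 := by
  obtain ⟨τ, -, hτ⟩ := exists_perm_move_first (σ.trans Fin.revPerm) i
  refine ⟨τ.trans Fin.revPerm, fun l hl => ?_⟩
  have hne : (σ l : ℕ) ≠ σ i := fun h => hl (σ.injective (Fin.ext h))
  have h1 := hτ l hl
  have h2 := (τ l).2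
  have h3 := (σ l).2
  have h4 := (σ i).2
  simp only [Equiv.trans_apply, Fin.revPerm_apply, Fin.val_rev] at h1 ⊢
  split_ifs at h1 ⊢ <;> omega

/-- Every arrangement `σ` of the points in a row of `n` positions makes each of the points in the
first `K` positions generated below the bound which vanishes on these positions and is given by `β`
on the remaining ones. -/
def Available {n : ℕ} (h : Fin n → ℕ) (K : ℕ) (β : ℕ → ℕ) : Prop :=
  ∀ (σ : Equiv.Perm (Fin n)) (i : Fin n), (σ i : ℕ) < K →
    ReachesBelow h i fun l => if (σ l : ℕ) < K then 0 else β (σ l)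

theorem Available.mono {n : ℕ} {h : Fin n → ℕ} {K : ℕ} {β β' : ℕ → ℕ}
    (hβ : Available h K β) (hle : ∀ p, K ≤ p → p < n → β p ≤ β' p) : Available h K β' := by
  intro σ i hi
  refine (hβ σ i hi).mono fun l => ?_
  dsimp only
  split_ifs with hl
  · exact le_rfl
  · exact hle _ (not_lt.1 hl) (σ l).2

theorem Available.step {n M : ℕ} {h : Fin n → ℕ} (hM : ∀ l, M < h l) {K k : ℕ} {β : ℕ → ℕ}
    (hβ : Available h K β) (hk : k ≤ K)
    (hle : ∀ p, k ≤ p → p < n → (if p < K then 1 else k * β p + 1) ≤ M) :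
    Available h (k + 1) fun p => if p - 1 < K then 1 else k * β (p - 1) + 1 := by
  intro σ i hi
  obtain ⟨τ, hτ⟩ := exists_perm_move_last σ i
  set b : Fin n → Fin n → ℕ := fun j =>
    if (τ j : ℕ) < k then fun l => if (τ l : ℕ) < K then 0 else β (τ l) else oneAt j with hb
  have hreach : ∀ j, ReachesBelow h j (b j) := by
    intro j
    by_cases hj : (τ j : ℕ) < k
    · simpa only [hb, if_pos hj] using hβ τ j (hj.trans_le hk)
    · simpa only [hb, if_neg hj] using reachesBelow_oneAt h j
  have hcard : (Finset.univ.filter fun j => (τ j : ℕ) < k).card ≤ k := by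
    have := Finset.card_le_card_of_injOn (s := Finset.univ.filter fun j => (τ j : ℕ) < k)
      (t := Finset.range k) (fun j => (τ j : ℕ)) (fun j hj => by simpa using hj)
      (fun a _ c _ hac => τ.injective (Fin.ext hac))
    simpa using this
  have hsum : ∀ l, ∑ j, b j l ≤
      k * (if (τ l : ℕ) < K then 0 else β (τ l)) + if (τ l : ℕ) < k then 0 else 1 := by
    intro l
    have : ∀ j, b j l = (if (τ j : ℕ) < k then (if (τ l : ℕ) < K then 0 else β (τ l)) else 0) +
        if l = j then (if (τ l : ℕ) < k then 0 else 1) else 0 := by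
      intro j
      by_cases hlj : l = j
      · subst hlj
        by_cases hj : (τ l : ℕ) < k <;> simp [hb, hj, oneAt]
      · by_cases hj : (τ j : ℕ) < k <;> simp [hb, hj, oneAt, hlj]
    simp only [this, Finset.sum_add_distrib, Finset.sum_ite_eq, Finset.mem_univ, if_true]
    rw [← Finset.sum_filter, Finset.sum_const, smul_eq_mul]
    exact Nat.add_le_add_right (Nat.mul_le_mul_right _ hcard) _
  have hsum_zero : ∀ l, (τ l : ℕ) < k → ∑ j, b j l = 0 := by
    intro l hl
    have := hsum l
    simpa [hl, hl.trans_le hk] using this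
  have hsum_le : ∀ l, k ≤ (τ l : ℕ) →
      ∑ j, b j l ≤ if (τ l : ℕ) < K then 1 else k * β (τ l) + 1 := by
    intro l hl
    have := hsum l
    split_ifs at this ⊢ <;> omega
  refine (reachesBelow_update_sum hreach (fun l => ?_) i).mono fun l => ?_
  · by_cases hl : (τ l : ℕ) < k
    · rw [hsum_zero l hl]
      exact (Nat.zero_le _).trans_lt (hM l)
    · exact ((hsum_le l (not_lt.1 hl)).trans (hle _ (not_lt.1 hl) (τ l).2)).trans_lt (hM l)
  · by_cases hl : l = i
    · subst hl
      simp
    · rw [Function.update_of_ne hl, Finset.sum_apply]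
      have h1 := hτ l hl
      have hne : (σ l : ℕ) ≠ σ i := fun h => hl (σ.injective (Fin.ext h))
      by_cases hlk : (σ l : ℕ) < k + 1
      · rw [hsum_zero l (by split_ifs at h1 <;> omega)]
        exact Nat.zero_le _
      · have h2 : (τ l : ℕ) = σ l - 1 := by split_ifs at h1 <;> omega
        have := hsum_le l (by omega)
        rw [h2] at this
        simpa only [if_neg hlk] using this

theorem geomSum_mono {k j j' : ℕ} (hj : j ≤ j') :
    ∑ i ∈ Finset.range j, k ^ i ≤ ∑ i ∈ Finset.range j', k ^ i :=
  Finset.sum_le_sum_of_subset (Finset.range_mono hj)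

theorem available_geomSum {n M : ℕ} {h : Fin n → ℕ} (hM : ∀ l, M < h l) (hn : 1 ≤ n)
    (hgeom : ∀ k, 1 ≤ k → k ≤ n → ∑ i ∈ Finset.range (n + 1 - k), k ^ i ≤ M) :
    ∀ k ≤ n, Available h (k + 1) fun p => ∑ i ∈ Finset.range (p - k), k ^ i := by
  intro k
  induction k with
  | zero =>
    intro _
    have h1 : 1 ≤ M := by simpa using hgeom n hn le_rfl
    have h0 : Available h 0 0 := fun σ i hi => absurd hi (Nat.not_lt_zero _)
    refine (h0.step hM (k := 0) le_rfl fun p _ _ => by simpa using h1).mono fun p hp _ => ?_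
    simpa using geomSum_mono (k := 0) (show 1 ≤ p from hp)
  | succ k ih =>
    intro hk
    have hkn := hgeom (k + 1) (by omega) hk
    set c : ℕ → ℕ := fun j => ∑ i ∈ Finset.range j, (k + 1) ^ i with hc
    have hcs : ∀ j, (k + 1) * c j + 1 = c (j + 1) := fun j => geom_sum_succ.symm
    have hcm : Monotone c := fun _ _ => geomSum_mono
    have key : ∀ t, Available h (k + 1 + 1) fun p =>
        if p ≤ k + 1 + t then c (p - (k + 1)) else c (p - (k + 1) + 1) := by
      intro t
      induction t with
      | zero =>
        have h0 : Available h (k + 1) fun p => c (p - k) :=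
          (ih (by omega)).mono fun p _ _ =>
            Finset.sum_le_sum fun i _ => Nat.pow_le_pow_left (Nat.le_succ k) i
        refine (h0.step hM le_rfl fun p hp hpn => ?_).mono fun p hp hpn => ?_
        · rw [if_neg (by omega), hcs]
          exact (hcm (by omega)).trans hkn
        · rw [if_neg (by omega), if_neg (by omega), hcs]
          exact hcm (by omega)
      | succ t iht =>
        refine (iht.step hM (Nat.le_succ _) fun p hp hpn => ?_).mono fun p hp hpn => ?_
        · split_ifs
          · exact le_trans (by simp [c]) ((hcm (show 1 ≤ n + 1 - (k + 1) by omega)).trans hkn)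
          · rw [hcs]
            exact (hcm (by omega)).trans hkn
          · rw [hcs]
            exact (hcm (by omega)).trans hkn
        · split_ifs <;> first | omega | skip
          · exact le_trans (by simp [c]) (hcm (show 1 ≤ p - (k + 1) by omega))
          · rw [hcs]
            exact hcm (by omega)
          · rw [hcs]
            exact hcm (by omega)
    refine (key n).mono fun p _ hpn => ?_
    rw [if_pos (by omega)]

theorem isZeroGenerating_of_varphiN_lt {n : ℕ} (hn : 1 ≤ n) {h : Fin n → ℕ}
    (hM : ∀ l, varphiN (n + 1) < h l) : IsZeroGenerating h := by
  have hgeom : ∀ k, 1 ≤ k → k ≤ n → ∑ i ∈ Finset.range (n + 1 - k), k ^ i ≤ varphiN (n + 1) :=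
    fun k hk hkn => Finset.le_sup (f := fun k => ∑ i ∈ Finset.range (n + 1 - k), k ^ i)
      (Finset.mem_Ioo.2 ⟨hk, by omega⟩)
  have := available_geomSum hM hn hgeom n le_rfl 1 ⟨0, hn⟩ (by simp)
  refine isZeroGenerating_of_reachesBelow_zero (i := ⟨0, hn⟩) (this.mono fun l => ?_)
  exact (if_pos (Nat.lt_succ_of_lt (Fin.is_lt _))).le

theorem sMinusInfty_le_varphiN {n : ℕ} (hn : 1 ≤ n) : sMinusInfty n ≤ (varphiN (n + 1) : ℕ∞) := by
  refine iSup₂_le fun h hh => ?_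
  by_contra! hlt
  refine hh (isZeroGenerating_of_varphiN_lt hn fun l => ?_)
  exact_mod_cast hlt.trans_le (iInf_le _ l)

theorem sum_range_pow_le_sum_pow {X : ℝ} (hX : 1 ≤ X) (s : Finset ℕ) :
    ∑ p ∈ Finset.range s.card, X ^ p ≤ ∑ p ∈ s, X ^ p := by
  induction s using Finset.induction_on_max with
  | empty => simp
  | insert a s ha ih =>
    have hmem : a ∉ s := fun h => lt_irrefl a (ha a h)
    have hcard : s.card ≤ a := by
      simpa using Finset.card_le_card (t := Finset.range a) fun p hp => Finset.mem_range.2 (ha p hp)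
    rw [Finset.card_insert_of_notMem hmem, Finset.sum_range_succ, Finset.sum_insert hmem, add_comm]
    exact add_le_add (pow_le_pow_right₀ hX hcard) ih

/-- A vector is heavy if all its weighted sums, with the weights `1, X, …, X ^ (n - 1)` assigned to
the coordinates in an arbitrary order, are at least `A`. -/
def IsHeavy {n : ℕ} (X A : ℝ) (y : Fin n → ℕ) : Prop :=
  ∀ σ : Equiv.Perm (Fin n), A ≤ ∑ l, X ^ (σ l : ℕ) * (y l : ℝ)

theorem isHeavy_of_mem_genStep {n M : ℕ} {X A : ℝ} (hX : 1 ≤ X)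
    (hA : ∀ u v : ℕ, u + v = n → X * A + M ≤ v * A + ∑ p ∈ Finset.range u, X ^ p)
    {B : Fin n → Set (Fin n → ℕ)} (hB : ∀ j, ∀ y ∈ B j, y = oneAt j ∨ IsHeavy X A y)
    {i : Fin n} {y : Fin n → ℕ} (hy : y ∈ genStep (fun _ => M + 1) B i) : IsHeavy X A y := by
  classical
  obtain ⟨x, ⟨hxM, a, ha, rfl⟩, rfl⟩ := hy
  set x := ∑ j, a j with hx
  intro σ
  obtain ⟨τ, hτi, hτ⟩ := exists_perm_move_first σ i
  set U := Finset.univ.filter fun j => a j = oneAt j with hU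
  set V := Finset.univ.filter fun j => ¬ a j = oneAt j with hV
  have hUV : U.card + V.card = n := by
    simpa using Finset.card_filter_add_card_filter_not (s := (Finset.univ : Finset (Fin n)))
      (fun j => a j = oneAt j)
  have hunits : ∑ p ∈ Finset.range U.card, X ^ p ≤ ∑ j ∈ U, ∑ l, X ^ (τ l : ℕ) * (a j l : ℝ) := by
    have h1 := sum_range_pow_le_sum_pow hX (U.image fun j => (τ j : ℕ))
    have hinj : Function.Injective fun j => (τ j : ℕ) := fun b c h => τ.injective (Fin.ext h)
    rw [Finset.card_image_of_injective _ hinj, Finset.sum_image hinj.injOn] at h1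
    refine h1.trans (Finset.sum_le_sum fun j hj => ?_)
    rw [(Finset.mem_filter.1 hj).2]
    simp [oneAt]
  have hheavy : V.card * A ≤ ∑ j ∈ V, ∑ l, X ^ (τ l : ℕ) * (a j l : ℝ) := by
    rw [← nsmul_eq_mul]
    exact Finset.card_nsmul_le_sum _ _ _ fun j hj =>
      (hB j _ (ha j)).resolve_left (Finset.mem_filter.1 hj).2 τ
  have htotal : ∑ l, X ^ (τ l : ℕ) * (x l : ℝ) =
      ∑ j ∈ U, ∑ l, X ^ (τ l : ℕ) * (a j l : ℝ) + ∑ j ∈ V, ∑ l, X ^ (τ l : ℕ) * (a j l : ℝ) := by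
    rw [hU, hV, Finset.sum_filter_add_sum_filter_not, Finset.sum_comm]
    refine Finset.sum_congr rfl fun l _ => ?_
    rw [hx, Finset.sum_apply, Nat.cast_sum, Finset.mul_sum]
  have hdrop : ∑ l, X ^ (τ l : ℕ) * (x l : ℝ) ≤
      M + X * ∑ l, X ^ (σ l : ℕ) * ((x - x i • oneAt i) l : ℕ) := by
    rw [← Finset.add_sum_erase _ _ (Finset.mem_univ i), Finset.mul_sum,
      ← Finset.add_sum_erase Finset.univ (fun l => X * _) (Finset.mem_univ i)]
    have hxi : (x i : ℝ) ≤ M := by exact_mod_cast Nat.lt_succ_iff.1 (hxM i)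
    have hle : ∑ l ∈ Finset.univ.erase i, X ^ (τ l : ℕ) * (x l : ℝ) ≤
        ∑ l ∈ Finset.univ.erase i, X * (X ^ (σ l : ℕ) * ((x - x i • oneAt i) l : ℕ)) := by
      refine Finset.sum_le_sum fun l hl => ?_
      have hli := Finset.ne_of_mem_erase hl
      have h1 : (x - x i • oneAt i) l = x l := by simp [oneAt, hli]
      rw [h1, ← mul_assoc, ← pow_succ']
      refine mul_le_mul_of_nonneg_right (pow_le_pow_right₀ hX ?_) (Nat.cast_nonneg _)
      rw [hτ l hli]
      split_ifs <;> omega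
    have h0 : (x - x i • oneAt i) i = 0 := by simp [oneAt]
    rw [hτi, h0]
    simpa using add_le_add hxi hle
  have h1 := hA _ _ hUV
  have h2 : X * A ≤ X * ∑ l, X ^ (σ l : ℕ) * ((x - x i • oneAt i) l : ℕ) := by linarith
  exact le_of_mul_le_mul_left h2 (by linarith)

theorem not_isZeroGenerating_const {n M : ℕ} {X A : ℝ} (hX : 1 ≤ X) (hA0 : 0 < A)
    (hA : ∀ u v : ℕ, u + v = n → X * A + M ≤ v * A + ∑ p ∈ Finset.range u, X ^ p) :
    ¬ IsZeroGenerating fun _ : Fin n => M + 1 := by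
  have hbracket : ∀ m j, ∀ y ∈ bracketSet (fun _ : Fin n => M + 1) m j,
      y = oneAt j ∨ IsHeavy X A y := by
    intro m
    induction m with
    | zero => exact fun j y hy => Or.inl hy
    | succ m ih =>
      rintro j y (hy | hy)
      · exact Or.inr (isHeavy_of_mem_genStep hX hA ih hy)
      · exact ih j y hy
  rintro ⟨i, m, hm⟩
  cases m with
  | zero =>
    have := congrFun (show (0 : Fin n → ℕ) = oneAt i from hm) i
    simp [oneAt] at this
  | succ m =>
    have := isHeavy_of_mem_genStep hX hA (hbracket m) hm 1
    simp at this
    linarith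

theorem le_sMinusInfty_of_not_isZeroGenerating {n m : ℕ}
    (h : ¬ IsZeroGenerating fun _ : Fin n => m) : (m : ℕ∞) ≤ sMinusInfty n :=
  le_trans (le_iInf fun _ => le_rfl)
    (le_iSup₂ (f := fun (h : Fin n → ℕ) (_ : ¬ IsZeroGenerating h) => ⨅ i, (h i : ℕ∞)) _ h)

theorem not_isZeroGenerating_of_le_phi_apply {n M : ℕ} {X : ℝ} (hX : 1 < X)
    (hM : (M : ℝ) ≤ (X ^ ((n : ℝ) - X) - 1) / (X - 1)) :
    ¬ IsZeroGenerating fun _ : Fin n => M + 1 := by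
  have hX0 : 0 < X := by linarith
  have hX1 : 0 < X - 1 := by linarith
  refine not_isZeroGenerating_const (A := X ^ ((n : ℝ) - X) * Real.log X / (X - 1)) hX.le
    (div_pos (mul_pos (Real.rpow_pos_of_pos hX0 _) (Real.log_pos hX)) hX1) fun u v huv => ?_
  have hpow : X ^ u = X ^ ((n : ℝ) - X) * Real.exp ((X - v) * Real.log X) := by
    rw [mul_comm (X - v), ← Real.rpow_def_of_pos hX0, ← Real.rpow_add hX0, ← Real.rpow_natCast,
      ← huv]
    push_cast
    ring_nf
  have hexp := mul_le_mul_of_nonneg_left (Real.add_one_le_exp ((X - v) * Real.log X))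
    (Real.rpow_nonneg hX0.le ((n : ℝ) - X))
  rw [← hpow] at hexp
  rw [geom_sum_eq hX.ne']
  refine (add_le_add_right hM _).trans ?_
  have h0 : 0 ≤ (X ^ u - X ^ ((n : ℝ) - X) * ((X - v) * Real.log X + 1)) / (X - 1) :=
    div_nonneg (by linarith) hX1.le
  rw [← sub_nonneg]
  refine h0.trans_eq ?_
  generalize X ^ ((n : ℝ) - X) = P
  generalize Real.log X = L
  ring

theorem not_isZeroGenerating_of_lt {n M : ℕ} (hM : M < n) :
    ¬ IsZeroGenerating fun _ : Fin n => M + 1 := by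
  refine not_isZeroGenerating_const (X := 1) (A := 1) le_rfl one_pos fun u v huv => ?_
  have h1 : 1 + M ≤ v + u := by omega
  have h2 : (1 + M : ℝ) ≤ v + u := by exact_mod_cast h1
  simpa using h2

theorem phi_apply_le_geom_sum {n : ℕ} (hn : 1 ≤ n) {x : ℝ} (hx : 1 < x) :
    (x ^ ((n : ℝ) - x) - 1) / (x - 1) ≤ ∑ i ∈ Finset.range (n - 1), x ^ i := by
  rw [geom_sum_eq hx.ne']
  refine div_le_div_of_nonneg_right (sub_le_sub_right ?_ _) (by linarith)
  rw [← Real.rpow_natCast, Nat.cast_sub hn]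
  exact Real.rpow_le_rpow_of_exponent_le hx.le (by push_cast; linarith)

theorem bddAbove_phi {n : ℕ} (hn : 1 ≤ n) :
    BddAbove ((fun x : ℝ => (x ^ ((n : ℝ) - x) - 1) / (x - 1)) '' Set.Ioo 1 (n : ℝ)) := by
  refine ⟨∑ i ∈ Finset.range (n - 1), (n : ℝ) ^ i, ?_⟩
  rintro _ ⟨x, ⟨hx1, hxn⟩, rfl⟩
  exact (phi_apply_le_geom_sum hn hx1).trans
    (Finset.sum_le_sum fun i _ => pow_le_pow_left₀ (by linarith) hxn.le i)

theorem div_le_phi_apply {n : ℕ} {x : ℝ} (hx : 1 < x) (hxn : x ≤ n) :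
    ((n : ℝ) - x) / x ≤ (x ^ ((n : ℝ) - x) - 1) / (x - 1) := by
  have hx0 : 0 < x := by linarith
  have hx1 : 0 < x - 1 := by linarith
  rw [le_div_iff₀ hx1, Real.rpow_def_of_pos hx0]
  have h1 := Real.one_sub_inv_le_log_of_pos hx0
  have h2 := Real.add_one_le_exp (Real.log x * ((n : ℝ) - x))
  have h3 := mul_le_mul_of_nonneg_right h1 (sub_nonneg.2 hxn)
  have h4 : ((n : ℝ) - x) / x * (x - 1) = (1 - x⁻¹) * ((n : ℝ) - x) := by
    field_simp
  linarith

theorem sub_one_le_phiR {n : ℕ} (hn : 2 ≤ n) : (n : ℝ) - 1 ≤ phiR n := by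
  have hn1 : (1 : ℝ) < n := by exact_mod_cast hn
  have hcont : Filter.Tendsto (fun x : ℝ => ((n : ℝ) - x) / x) (nhdsWithin 1 (Set.Ioi 1))
      (nhds ((n : ℝ) - 1)) := by
    have : ContinuousAt (fun x : ℝ => ((n : ℝ) - x) / x) 1 := by fun_prop (disch := norm_num)
    simpa [ContinuousAt] using this.tendsto.mono_left nhdsWithin_le_nhds
  refine le_of_tendsto hcont ?_
  filter_upwards [Ioo_mem_nhdsGT hn1] with x hx
  exact (div_le_phi_apply hx.1 hx.2.le).trans
    (le_csSup (bddAbove_phi (by omega)) (Set.mem_image_of_mem _ hx))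

theorem varphiN_le_phiR {n : ℕ} (hn : 2 ≤ n) : (varphiN n : ℝ) ≤ phiR n := by
  have hne : (Finset.Ioo 0 n).Nonempty := ⟨1, Finset.mem_Ioo.2 ⟨one_pos, hn⟩⟩
  obtain ⟨k, hk, hkn⟩ := Finset.exists_mem_eq_sup _ hne
    fun k => ∑ i ∈ Finset.range (n - k), k ^ i
  rw [varphiN, hkn]
  obtain ⟨hk0, hkn⟩ := Finset.mem_Ioo.1 hk
  rcases (show 1 ≤ k from hk0).eq_or_lt with rfl | hk1
  · simpa [Nat.cast_sub hk0, Nat.cast_sub (show 1 ≤ n by omega)] using sub_one_le_phiR hn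
  · have hk1' : (1 : ℝ) < k := by exact_mod_cast hk1
    refine le_csSup (bddAbove_phi (by omega)) ⟨k, ⟨hk1', by exact_mod_cast hkn⟩, ?_⟩
    push_cast
    rw [geom_sum_eq hk1'.ne', ← Real.rpow_natCast, Nat.cast_sub hkn.le]

/-- If `phiR n` exceeds the limit value `n - 1` at the left end, then it is attained. -/
theorem exists_phiR_le {n : ℕ} (hn : 2 ≤ n) (h : (n : ℝ) - 1 < phiR n) :
    ∃ X : ℝ, 1 < X ∧ phiR n ≤ (X ^ ((n : ℝ) - X) - 1) / (X - 1) := by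
  have hn1 : (1 : ℝ) < n := by exact_mod_cast hn
  set f : ℝ → ℝ := fun x => (x ^ ((n : ℝ) - x) - 1) / (x - 1) with hf
  have hne : (f '' Set.Ioo 1 (n : ℝ)).Nonempty := (Set.nonempty_Ioo.2 hn1).image f
  obtain ⟨_, ⟨x₀, hx₀, rfl⟩, hlt⟩ := exists_lt_of_lt_csSup hne h
  have hgeom : Continuous fun x : ℝ => ∑ i ∈ Finset.range (n - 1), x ^ i := by fun_prop
  have hnear : ∀ᶠ x : ℝ in nhds 1, ∑ i ∈ Finset.range (n - 1), x ^ i < f x₀ := by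
    refine hgeom.continuousAt.eventually_lt continuousAt_const ?_
    simpa [Nat.cast_sub (show 1 ≤ n by omega)] using hlt
  obtain ⟨ε, hε, hball⟩ := Metric.eventually_nhds_iff.1 hnear
  have hsmall : ∀ x, 1 < x → x < 1 + ε → f x < f x₀ := fun x hx hxε =>
    (phi_apply_le_geom_sum (by omega) hx).trans_lt (hball (by
      rw [Real.dist_eq, abs_of_pos (by linarith)]; linarith))
  have hx₀ε : 1 + ε ≤ x₀ := le_of_not_gt fun hlt => lt_irrefl _ (hsmall x₀ hx₀.1 hlt)
  have hcont : ContinuousOn f (Set.Icc (1 + ε) n) := by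
    refine ContinuousOn.div (ContinuousOn.sub (ContinuousOn.rpow (by fun_prop) (by fun_prop)
      fun x hx => Or.inl ?_) (by fun_prop)) (by fun_prop) fun x hx => ?_
    · have := hx.1; linarith
    · have := hx.1; linarith
  obtain ⟨X, hX, hmax⟩ := isCompact_Icc.exists_isMaxOn ⟨x₀, hx₀ε, hx₀.2.le⟩ hcont
  refine ⟨X, by linarith [hX.1], csSup_le hne ?_⟩
  rintro _ ⟨x, hx, rfl⟩
  rcases lt_or_ge x (1 + ε) with hxε | hxε
  · exact (hsmall x hx.1 hxε).le.trans (hmax ⟨hx₀ε, hx₀.2.le⟩)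
  · exact hmax ⟨hxε, hx.2.le⟩

theorem floor_phiR_add_one_le_sMinusInfty {n : ℕ} (hn : 2 ≤ n) :
    ((⌊phiR n⌋₊ + 1 : ℕ) : ℕ∞) ≤ sMinusInfty n := by
  apply le_sMinusInfty_of_not_isZeroGenerating
  rcases (sub_one_le_phiR hn).eq_or_lt with h | h
  · refine not_isZeroGenerating_of_lt ?_
    rw [← h, ← Nat.cast_one, ← Nat.cast_sub (by omega), Nat.floor_natCast]
    omega
  · obtain ⟨X, hX, hle⟩ := exists_phiR_le hn h
    have h0 : 0 ≤ phiR n := by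
      have : (1 : ℝ) < n := by exact_mod_cast hn
      linarith
    exact not_isZeroGenerating_of_le_phi_apply hX ((Nat.floor_le h0).trans hle)

/-- For every `n ≥ 2`: `varphi(n) ≤ φ(n) < s₋∞(n) ≤ varphi(n+1) ≤ φ(n+1)`;
in particular `s₋∞(n)` is finite. -/
theorem bound_s (n : ℕ) (hn : 2 ≤ n) :
    sMinusInfty n ≠ ⊤ ∧
    (varphiN n : ℝ) ≤ phiR n ∧
    phiR n < ((sMinusInfty n).toNat : ℝ) ∧
    ((sMinusInfty n).toNat : ℝ) ≤ (varphiN (n + 1) : ℝ) ∧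
    (varphiN (n + 1) : ℝ) ≤ phiR (n + 1) := by
  have hle := sMinusInfty_le_varphiN (show 1 ≤ n by omega)
  have hfloor := floor_phiR_add_one_le_sMinusInfty hn
  have htop : sMinusInfty n ≠ ⊤ := ne_top_of_le_ne_top (ENat.natCast_ne_top _) hle
  refine ⟨htop, varphiN_le_phiR hn, ?_, ?_, varphiN_le_phiR (by omega)⟩
  · rw [← ENat.natCast_toNat htop] at hfloor
    have h1 : ⌊phiR n⌋₊ + 1 ≤ (sMinusInfty n).toNat := by exact_mod_cast hfloor
    refine (Nat.lt_floor_add_one (phiR n)).trans_le ?_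
    exact_mod_cast h1
  · rw [← ENat.natCast_toNat htop] at hle
    exact_mod_cast hle
end

section
/- Let n ≥ 2 and let ℏ : Fin n → ℕ be a constant function. Then ℏ is 0-generating if and only if the zero function belongs to ℏ^{(ω]} = ⋃_{m∈ℕ} ℏ^{(m]}. -/
/-- The indicator function `1_{n∖k} : Fin n → ℕ` of `{j : k ≤ j}`. -/
def indGE (n k : ℕ) : Fin n → ℕ := fun j => if k ≤ (j : ℕ) then 1 else 0

/-- The pointwise sumset `Σ^k A` of `k` copies of `A` (with `Σ^0 A = {0}`). -/
def iterSumset {n : ℕ} (A : Set (Fin n → ℕ)) : ℕ → Set (Fin n → ℕ)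
  | 0 => {0}
  | k + 1 => {x | ∃ a ∈ A, ∃ b ∈ iterSumset A k, x = a + b}

/-- The last index `n - 1` of `Fin n`. -/
def lastIdx (n : ℕ) [NeZero n] : Fin n :=
  ⟨n - 1, Nat.sub_lt (Nat.pos_of_ne_zero (NeZero.ne n)) one_pos⟩

/-- The sets `ℏ^{(m]}`. -/
def parenSet {n : ℕ} [NeZero n] (h : Fin n → ℕ) : ℕ → Set (Fin n → ℕ)
  | 0 => ∅
  | m + 1 => parenSet h m ∪
      {y | ∃ σ : Equiv.Perm (Fin n), ∃ x : Fin n → ℕ,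
        (x ∈ lowerCone h ∧
          ∃ k < n, ∃ a ∈ iterSumset (parenSet h m) k, x = indGE n k + a) ∧
        y = (x - x (lastIdx n) • oneAt (lastIdx n)) ∘ σ}

theorem parenSet_mono {n : ℕ} [NeZero n] (h : Fin n → ℕ) : Monotone (parenSet h) :=
  monotone_nat_of_le_succ fun _ => Set.subset_union_left

theorem oneAt_comp_perm {n : ℕ} (i : Fin n) (σ : Equiv.Perm (Fin n)) :
    oneAt i ∘ σ = oneAt (σ.symm i) := by
  funext j
  simp only [oneAt, Function.comp_apply, Equiv.eq_symm_apply]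

theorem lowerCone_comp_perm {n : ℕ} {h : Fin n → ℕ} (hconst : ∀ i j, h i = h j)
    {x : Fin n → ℕ} (hx : x ∈ lowerCone h) (σ : Equiv.Perm (Fin n)) :
    x ∘ σ ∈ lowerCone h := fun i => (hx (σ i)).trans_eq (hconst _ _)

theorem sub_smul_oneAt_apply {n : ℕ} (x : Fin n → ℕ) (i j : Fin n) :
    (x - x i • oneAt i) j = if j = i then 0 else x j := by
  simp only [Pi.sub_apply, Pi.smul_apply, oneAt, smul_eq_mul]
  split_ifs with hj <;> simp [hj]

theorem sub_smul_oneAt_mono {n : ℕ} {x y : Fin n → ℕ} (hxy : x ≤ y) (i : Fin n) :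
    x - x i • oneAt i ≤ y - y i • oneAt i := fun j => by
  rw [sub_smul_oneAt_apply, sub_smul_oneAt_apply]
  split_ifs
  exacts [le_rfl, hxy j]

theorem sub_smul_oneAt_comp_perm {n : ℕ} (x : Fin n → ℕ) (i : Fin n)
    (σ : Equiv.Perm (Fin n)) :
    (x - x i • oneAt i) ∘ σ = x ∘ σ - (x ∘ σ) (σ.symm i) • oneAt (σ.symm i) := by
  funext j
  rw [Function.comp_apply, sub_smul_oneAt_apply, sub_smul_oneAt_apply]
  simp only [Equiv.eq_symm_apply, Function.comp_apply]

theorem genStep_comp_perm {n : ℕ} {h : Fin n → ℕ} (hconst : ∀ i j, h i = h j)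
    {B : Fin n → Set (Fin n → ℕ)} (σ : Equiv.Perm (Fin n))
    (hB : ∀ j, ∀ y ∈ B j, y ∘ σ ∈ B (σ.symm j)) {i : Fin n} {y : Fin n → ℕ}
    (hy : y ∈ genStep h B i) : y ∘ σ ∈ genStep h B (σ.symm i) := by
  obtain ⟨x, ⟨hx, a, ha, hsum⟩, rfl⟩ := hy
  refine ⟨x ∘ σ, ⟨lowerCone_comp_perm hconst hx σ, fun j => a (σ j) ∘ σ, fun j => ?_, ?_⟩,
    sub_smul_oneAt_comp_perm x i σ⟩
  · simpa using hB _ _ (ha (σ j))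
  · funext t
    simp only [hsum, Function.comp_apply, Finset.sum_apply]
    exact (Equiv.sum_comp σ fun j => a j (σ t)).symm

theorem bracketSet_comp_perm {n : ℕ} {h : Fin n → ℕ} (hconst : ∀ i j, h i = h j)
    (σ : Equiv.Perm (Fin n)) (m : ℕ) (i : Fin n) (y : Fin n → ℕ)
    (hy : y ∈ bracketSet h m i) : y ∘ σ ∈ bracketSet h m (σ.symm i) := by
  induction m generalizing i y with
  | zero =>
    obtain rfl : y = oneAt i := hy
    exact oneAt_comp_perm i σ
  | succ m ih => exact hy.imp (genStep_comp_perm hconst σ ih) (ih i y)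

theorem parenSet_comp_perm {n : ℕ} [NeZero n] (h : Fin n → ℕ) (σ : Equiv.Perm (Fin n)) (m : ℕ)
    (y : Fin n → ℕ) (hy : y ∈ parenSet h m) : y ∘ σ ∈ parenSet h m := by
  induction m with
  | zero => exact hy.elim
  | succ m ih =>
    refine hy.imp ih ?_
    rintro ⟨τ, x, hx, rfl⟩
    exact ⟨σ.trans τ, x, hx, rfl⟩

/-- The functions produced by at least one generation step, at any index. -/
def generatedSet {n : ℕ} (h : Fin n → ℕ) : Set (Fin n → ℕ) :=
  {y | ∃ i m, y ∈ genStep h (bracketSet h m) i}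

theorem generatedSet_comp_perm {n : ℕ} {h : Fin n → ℕ} (hconst : ∀ i j, h i = h j)
    (σ : Equiv.Perm (Fin n)) {y : Fin n → ℕ} (hy : y ∈ generatedSet h) :
    y ∘ σ ∈ generatedSet h := by
  obtain ⟨i, m, hy⟩ := hy
  exact ⟨σ.symm i, m, genStep_comp_perm hconst σ (bracketSet_comp_perm hconst σ m) hy⟩

theorem exists_mem_bracketSet_of_apply_eq_zero {n : ℕ} {h : Fin n → ℕ}
    (hconst : ∀ i j, h i = h j) {y : Fin n → ℕ} (hy : y ∈ generatedSet h) {z : Fin n}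
    (hz : y z = 0) : ∃ m, y ∈ bracketSet h m z := by
  obtain ⟨i, m, hy⟩ := hy
  have hi : y i = 0 := by
    obtain ⟨x, -, rfl⟩ := hy
    rw [sub_smul_oneAt_apply, if_pos rfl]
  refine ⟨m + 1, Or.inl ?_⟩
  have key := genStep_comp_perm hconst (Equiv.swap i z)
    (bracketSet_comp_perm hconst (Equiv.swap i z) m) hy
  have hswap : y ∘ Equiv.swap i z = y := by
    funext t
    rw [Function.comp_apply, Equiv.swap_apply_def]
    split_ifs with h1 h2
    · rw [hz, h1, hi]
    · rw [hi, h2, hz]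
    · rfl
  rwa [hswap, Equiv.symm_swap, Equiv.swap_apply_left] at key

theorem sub_smul_oneAt_mem_generatedSet {n : ℕ} {h : Fin n → ℕ} {a : Fin n → Fin n → ℕ}
    (ha : ∀ j, ∃ m, a j ∈ bracketSet h m j) (hlt : ∑ j, a j ∈ lowerCone h) (i : Fin n) :
    ∑ j, a j - (∑ j, a j) i • oneAt i ∈ generatedSet h := by
  choose m hm using ha
  exact ⟨i, Finset.univ.sup m, _, ⟨hlt, a, fun j =>
    bracketSet_mono h j (Finset.le_sup (Finset.mem_univ j)) (hm j), rfl⟩, rfl⟩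

theorem sum_oneAt_apply {n : ℕ} (s : Finset (Fin n)) (t : Fin n) :
    (∑ j ∈ s, oneAt j) t = if t ∈ s then 1 else 0 := by
  simp [Finset.sum_apply, oneAt]

theorem exists_sum_le_of_one_le {n : ℕ} {h : Fin n → ℕ} {k : ℕ} (I : Finset (Fin n))
    (a : Fin n → Fin n → ℕ) (ha : ∀ i ∈ I, ∃ m, a i ∈ bracketSet h m i)
    (c : Fin n → ℕ) (hc : ∀ j : Fin n, (j : ℕ) < k → j ∉ I → 1 ≤ c j) :
    ∃ a' : Fin n → Fin n → ℕ, (∀ j, ∃ m, a' j ∈ bracketSet h m j) ∧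
      ∑ j, a' j ≤ indGE n k + ∑ i ∈ I, a i + c := by
  refine ⟨fun j => if j ∈ I then a j else oneAt j, fun j => ?_, ?_⟩
  · by_cases hj : j ∈ I
    · simpa [hj] using ha j hj
    · exact ⟨0, by simp [hj, bracketSet]⟩
  · rw [Finset.sum_ite, Finset.filter_mem_eq_inter, Finset.univ_inter]
    intro t
    have hone := sum_oneAt_apply (Finset.univ.filter (· ∉ I)) t
    simp only [Finset.mem_filter, Finset.mem_univ, true_and] at hone
    simp only [Pi.add_apply, hone, indGE]
    have := hc t
    grind

/-- Greedily assign the summands of `b` to the indices below `k` at which they vanish. As soon as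
a summand vanishes at no unassigned index below `k`, it dominates all the missing `1_j`. -/
theorem exists_sum_le_of_mem_iterSumset {n : ℕ} {h : Fin n → ℕ} (hconst : ∀ i j, h i = h j)
    {A : Set (Fin n → ℕ)} (hA : ∀ p ∈ A, ∃ d ∈ generatedSet h, d ≤ p)
    {k : ℕ} (hk : k ≤ n) (r : ℕ) (b : Fin n → ℕ)
    (hb : b ∈ iterSumset A r) (I : Finset (Fin n)) (hI : ∀ i ∈ I, (i : ℕ) < k)
    (hcard : I.card + r = k) (a : Fin n → Fin n → ℕ)
    (ha : ∀ i ∈ I, ∃ m, a i ∈ bracketSet h m i) :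
    ∃ a' : Fin n → Fin n → ℕ, (∀ j, ∃ m, a' j ∈ bracketSet h m j) ∧
      ∑ j, a' j ≤ indGE n k + ∑ i ∈ I, a i + b := by
  induction r generalizing b I a with
  | zero =>
    refine exists_sum_le_of_one_le I a ha b fun j hj hjI => ?_
    have hsub : I ⊆ Finset.univ.filter fun i : Fin n => (i : ℕ) < k := fun i hi => by
      simpa using hI i hi
    have hle : (Finset.univ.filter fun i : Fin n => (i : ℕ) < k).card ≤ I.card := by
      rw [Fin.card_filter_val_lt]
      omega
    rw [Finset.eq_of_subset_of_card_le hsub hle] at hjI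
    simp [hj] at hjI
  | succ r ih =>
    obtain ⟨p, hp, b, hb, rfl⟩ := hb
    obtain ⟨d, hd, hdp⟩ := hA p hp
    by_cases hz : ∃ z : Fin n, (z : ℕ) < k ∧ z ∉ I ∧ d z = 0
    · obtain ⟨z, hzk, hzI, hz⟩ := hz
      have hne : ∀ i ∈ I, i ≠ z := fun i hi hiz => hzI (hiz ▸ hi)
      have ha₂ : ∀ i ∈ insert z I, ∃ m, Function.update a z d i ∈ bracketSet h m i := by
        intro i hi
        rcases Finset.mem_insert.1 hi with rfl | hi
        · simpa using exists_mem_bracketSet_of_apply_eq_zero hconst hd hz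
        · simpa [Function.update_of_ne (hne i hi)] using ha i hi
      have hI₂ : ∀ i ∈ insert z I, (i : ℕ) < k := by
        simpa [hzk] using hI
      have hcard₂ : (insert z I).card + r = k := by
        rw [Finset.card_insert_of_notMem hzI]
        omega
      obtain ⟨a', ha', hle⟩ := ih b hb (insert z I) hI₂ hcard₂ (Function.update a z d) ha₂
      refine ⟨a', ha', hle.trans ?_⟩
      rw [Finset.sum_insert hzI, Function.update_self,
        Finset.sum_congr rfl fun i hi => Function.update_of_ne (hne i hi) d a]
      calc indGE n k + (d + ∑ i ∈ I, a i) + b = indGE n k + ∑ i ∈ I, a i + (d + b) := by abel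
        _ ≤ indGE n k + ∑ i ∈ I, a i + (p + b) := by gcongr
    · push Not at hz
      refine exists_sum_le_of_one_le I a ha _ fun j hj hjI => ?_
      have h1 := hz j hj hjI
      have h2 : d j ≤ p j := hdp j
      simp only [Pi.add_apply]
      omega

theorem exists_generatedSet_le {n : ℕ} [NeZero n] {h : Fin n → ℕ} (hconst : ∀ i j, h i = h j)
    (m : ℕ) : ∀ p ∈ parenSet h m, ∃ d ∈ generatedSet h, d ≤ p := by
  induction m with
  | zero => exact fun p hp => hp.elim
  | succ m ih =>
    rintro p (hp | ⟨σ, x, ⟨hx, k, hk, b, hb, rfl⟩, rfl⟩)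
    · exact ih p hp
    · obtain ⟨a, ha, hle⟩ := exists_sum_le_of_mem_iterSumset hconst ih hk.le k b hb ∅
        (by simp) (by simp) (fun _ => 0) (by simp)
      rw [Finset.sum_empty, add_zero] at hle
      exact ⟨_, generatedSet_comp_perm hconst σ (sub_smul_oneAt_mem_generatedSet ha
        (fun j => (hle j).trans_lt (hx j)) (lastIdx n)),
        fun j => sub_smul_oneAt_mono hle (lastIdx n) (σ j)⟩

theorem sum_mem_iterSumset {n : ℕ} {A : Set (Fin n → ℕ)} {ι : Type*} (s : Finset ι)
    (f : ι → Fin n → ℕ) (hf : ∀ j ∈ s, f j ∈ A) : ∑ j ∈ s, f j ∈ iterSumset A s.card := by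
  classical
  induction s using Finset.induction_on with
  | empty => simp [iterSumset]
  | insert j s hj ih =>
    rw [Finset.sum_insert hj, Finset.card_insert_of_notMem hj]
    exact ⟨f j, hf j (by simp), _, ih fun i hi => hf i (by simp [hi]), rfl⟩

theorem exists_perm_lt_card_iff {n : ℕ} [NeZero n] (K : Finset (Fin n)) {i : Fin n} (hi : i ∉ K) :
    ∃ τ : Equiv.Perm (Fin n), (∀ j, (τ j : ℕ) < K.card ↔ j ∈ K) ∧ τ i = lastIdx n := by
  have hlt : K.card < n := by
    simpa using Finset.card_lt_univ_of_notMem hi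
  let e : {j // j ∈ K} ≃ {j : Fin n // (j : ℕ) < K.card} := Fintype.equivOfCardEq (by
    rw [Fintype.card_coe, Fintype.card_subtype, Fin.card_filter_val_lt]
    omega)
  have he (j : Fin n) : (e.extendSubtype j : ℕ) < K.card ↔ j ∈ K :=
    ⟨fun hj => by_contra fun hjK => e.extendSubtype_not_mem j hjK hj, e.extendSubtype_mem j⟩
  refine ⟨e.extendSubtype.trans (Equiv.swap (e.extendSubtype i) (lastIdx n)), fun j => ?_, by simp⟩
  have hilt : ¬ (e.extendSubtype i : ℕ) < K.card := (he i).not.2 hi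
  have hlast : ¬ (lastIdx n : ℕ) < K.card := by
    simp only [lastIdx]
    omega
  rw [← he j, Equiv.trans_apply, Equiv.swap_apply_def]
  split_ifs with h1 h2
  · rw [h1]
    exact iff_of_false hlast hilt
  · rw [h2]
    exact iff_of_false hilt hlast
  · rfl

theorem exists_sub_smul_oneAt_mem_parenSet {n : ℕ} [NeZero n] {h : Fin n → ℕ}
    (hconst : ∀ i j, h i = h j) {m : ℕ} (K : Finset (Fin n)) {i : Fin n} (hi : i ∉ K)
    (f : Fin n → Fin n → ℕ) (hf : ∀ j ∈ K, f j ∈ parenSet h m) {x : Fin n → ℕ}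
    (hx : x = ∑ j ∈ Kᶜ, oneAt j + ∑ j ∈ K, f j) (hlt : x ∈ lowerCone h) :
    x - x i • oneAt i ∈ parenSet h (m + 1) := by
  obtain ⟨τ, hτ, hτi⟩ := exists_perm_lt_card_iff K hi
  have hlt_n : K.card < n := by
    simpa using Finset.card_lt_univ_of_notMem hi
  refine Or.inr ⟨τ, x ∘ τ.symm, ⟨lowerCone_comp_perm hconst hlt _, K.card, hlt_n,
    ∑ j ∈ K, f j ∘ τ.symm, sum_mem_iterSumset K _ fun j hj =>
      parenSet_comp_perm h _ m _ (hf j hj), ?_⟩, ?_⟩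
  · funext t
    have ht := hτ (τ.symm t)
    rw [Equiv.apply_symm_apply] at ht
    rw [hx, Function.comp_apply, Pi.add_apply, sum_oneAt_apply]
    simp only [Finset.mem_compl, ← ht, not_lt, Pi.add_apply, Finset.sum_apply,
      Function.comp_apply, indGE]
  · rw [sub_smul_oneAt_comp_perm, ← hτi, Equiv.symm_apply_apply]
    simp [Function.comp_assoc]

theorem eq_oneAt_or_exists_parenSet_le {n : ℕ} [NeZero n] {h : Fin n → ℕ}
    (hconst : ∀ i j, h i = h j) (m : ℕ) (i : Fin n) (y : Fin n → ℕ)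
    (hy : y ∈ bracketSet h m i) :
    y = oneAt i ∨ y i = 0 ∧ ∃ p ∈ parenSet h m, p ≤ y := by
  induction m generalizing i y with
  | zero => exact Or.inl hy
  | succ m ih =>
    rcases hy with ⟨x, ⟨hx, a, ha, rfl⟩, rfl⟩ | hy
    · refine Or.inr ⟨by rw [sub_smul_oneAt_apply, if_pos rfl], ?_⟩
      by_cases hi : a i = oneAt i
      · classical
        let K := Finset.univ.filter fun j => a j ≠ oneAt j
        have hp (j : Fin n) : ∃ p, j ∈ K → p ∈ parenSet h m ∧ p ≤ a j := by
          by_cases hj : a j = oneAt j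
          · exact ⟨0, fun hjK => absurd hj (by simpa [K] using hjK)⟩
          · obtain ⟨-, p, hp, hle⟩ := (ih j _ (ha j)).resolve_left hj
            exact ⟨p, fun _ => ⟨hp, hle⟩⟩
        choose p hp using hp
        have hle : ∑ j ∈ Kᶜ, oneAt j + ∑ j ∈ K, p j ≤ ∑ j, a j := by
          rw [← Finset.sum_compl_add_sum K a]
          refine add_le_add (Finset.sum_le_sum fun j hj => ?_)
            (Finset.sum_le_sum fun j hj => (hp j hj).2)
          have hj : a j = oneAt j := by simpa [K] using hj
          exact hj.ge
        exact ⟨_, exists_sub_smul_oneAt_mem_parenSet hconst K (by simp [K, hi]) p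
          (fun j hj => (hp j hj).1) rfl fun j => (hle j).trans_lt (hx j),
          sub_smul_oneAt_mono hle i⟩
      · obtain ⟨hai, p, hp, hle⟩ := (ih i _ (ha i)).resolve_left hi
        refine ⟨p, parenSet_mono h m.le_succ hp, hle.trans fun t => ?_⟩
        rw [sub_smul_oneAt_apply]
        split_ifs with ht
        · rw [ht, hai]
        · exact Finset.single_le_sum (f := a) (fun _ _ => zero_le) (Finset.mem_univ i) t
    · exact (ih i y hy).imp_right fun ⟨h0, p, hp, hle⟩ =>
        ⟨h0, p, parenSet_mono h m.le_succ hp, hle⟩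

/-- Theorem characterizing constant `0`-generating functions: a constant `ℏ : Fin n → ℕ`
is `0`-generating iff the zero function belongs to `ℏ^{(ω]} = ⋃_m ℏ^{(m]}`. -/
theorem zero_generating_iff_mem_parenSet (n : ℕ) [NeZero n] (hn : 2 ≤ n)
    (h : Fin n → ℕ) (hconst : ∀ i j, h i = h j) :
    IsZeroGenerating h ↔ (0 : Fin n → ℕ) ∈ ⋃ m : ℕ, parenSet h m := by
  have hone (i : Fin n) : (0 : Fin n → ℕ) ≠ oneAt i := fun h0 => by
    simpa [oneAt] using congrFun h0 i
  rw [Set.mem_iUnion]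
  constructor
  · rintro ⟨i, m, hm⟩
    have hbracket : (0 : Fin n → ℕ) ∈ bracketSet h m i := by
      cases m with
      | zero => exact hm
      | succ m => exact Or.inl hm
    obtain ⟨-, p, hp, hle⟩ :=
      (eq_oneAt_or_exists_parenSet_le hconst m i 0 hbracket).resolve_left (hone i)
    exact ⟨m, nonpos_iff_eq_zero.1 hle ▸ hp⟩
  · rintro ⟨m, hm⟩
    obtain ⟨d, ⟨i, k, hd⟩, hle⟩ := exists_generatedSet_le hconst m 0 hm
    exact ⟨i, k + 1, nonpos_iff_eq_zero.1 hle ▸ hd⟩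
end

section
/- Let n ≥ 2 and let ℏ : Fin n → ℕ be a constant function. Then for every m ∈ ℕ and every i ∈ Fin n: ℏ^{(m]} ⊆ ↑ℏ^{[m]}(i). -/
/-- The upper set `↑A = {f : ∃ g ∈ A, g ≤ f pointwise}`. -/
def upperSet {n : ℕ} (A : Set (Fin n → ℕ)) : Set (Fin n → ℕ) :=
  {f | ∃ g ∈ A, ∀ i, g i ≤ f i}

theorem comp_perm_mem_parenSet {n : ℕ} [NeZero n] {h : Fin n → ℕ} {m : ℕ} {y : Fin n → ℕ}
    (hy : y ∈ parenSet h m) (τ : Equiv.Perm (Fin n)) : y ∘ τ ∈ parenSet h m := by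
  induction m with
  | zero => exact hy.elim
  | succ m ih =>
    rcases hy with hy | ⟨σ, x, hx, rfl⟩
    · exact Or.inl (ih hy)
    · exact Or.inr ⟨τ.trans σ, x, hx, rfl⟩

/-- An element of a `k`-fold sumset is a sum indexed by any given set of `k` indices. -/
theorem exists_eq_sum_of_mem_iterSumset {n : ℕ} {ι : Type*} [DecidableEq ι]
    {A : Set (Fin n → ℕ)} {k : ℕ} {a : Fin n → ℕ} (ha : a ∈ iterSumset A k)
    {S : Finset ι} (hS : S.card = k) :
    ∃ c : ι → Fin n → ℕ, (∀ j ∈ S, c j ∈ A) ∧ a = ∑ j ∈ S, c j := by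
  induction k generalizing a S with
  | zero =>
    obtain rfl := Finset.card_eq_zero.mp hS
    exact ⟨0, by simp, ha⟩
  | succ k ih =>
    obtain ⟨b, hb, d, hd, rfl⟩ := ha
    obtain ⟨s, T, hs, rfl, hT⟩ := Finset.card_eq_succ.mp hS
    obtain ⟨c, hc, rfl⟩ := ih hd hT
    have hne : ∀ j ∈ T, j ≠ s := fun j hj hjs => hs (hjs ▸ hj)
    refine ⟨Function.update c s b, fun j hj => ?_, ?_⟩
    · rcases Finset.mem_insert.mp hj with rfl | hj
      · simpa using hb
      · simpa [hne j hj] using hc j hj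
    · rw [Finset.sum_insert hs, Function.update_self]
      congr 1
      exact Finset.sum_congr rfl fun j hj => by simp [hne j hj]

theorem oneAt_mem_bracketSet {n : ℕ} (h : Fin n → ℕ) (m : ℕ) (i : Fin n) :
    oneAt i ∈ bracketSet h m i := by
  induction m with
  | zero => rfl
  | succ m ih => exact Or.inr ih

/-- If `B j` contains `1_j` and `A ⊆ ↑(B j)` for a permutation-invariant `A`, then permuted elements
of `1_{n∖k} + Σ^k A` lie above the sumset of the `B j`. -/
theorem comp_perm_mem_upperSet_sumset {n : ℕ} {A : Set (Fin n → ℕ)}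
    {B : Fin n → Set (Fin n → ℕ)} (hA : ∀ y ∈ A, ∀ σ : Equiv.Perm (Fin n), y ∘ σ ∈ A)
    (hAB : ∀ j, A ⊆ upperSet (B j)) (hB : ∀ j, oneAt j ∈ B j) {k : ℕ} (hk : k ≤ n)
    {a : Fin n → ℕ} (ha : a ∈ iterSumset A k) (σ : Equiv.Perm (Fin n)) :
    (indGE n k + a) ∘ σ ∈ upperSet (sumset B) := by
  have hcard : (Finset.univ.filter fun j : Fin n => (j : ℕ) < k).card = k := by
    simpa [Fin.card_filter_val_lt] using hk
  obtain ⟨c, hc, rfl⟩ := exists_eq_sum_of_mem_iterSumset ha hcard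
  have hb : ∀ j, ∃ g ∈ B j, ∀ t, g t ≤
      if (σ j : ℕ) < k then c (σ j) (σ t) else oneAt (σ j) (σ t) := by
    intro j
    split_ifs with hj
    · exact hAB j (hA _ (hc (σ j) (by simpa using hj)) σ)
    · exact ⟨oneAt j, hB j, fun t => by simp [oneAt]⟩
  choose b hbB hb using hb
  refine ⟨_, ⟨b, hbB, rfl⟩, fun t => ?_⟩
  rw [Finset.sum_apply]
  refine (Finset.sum_le_sum fun j _ => hb j t).trans_eq ?_
  rw [Equiv.sum_comp σ fun j => if (j : ℕ) < k then c j (σ t) else oneAt j (σ t),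
    Finset.sum_ite, add_comm]
  rw [Function.comp_apply, Pi.add_apply, Finset.sum_apply]
  congr 1
  simp [indGE, oneAt]

/-- Lemma: for a constant `ℏ`, every `m ∈ ℕ` and every `i`,
`ℏ^{(m]} ⊆ ↑ℏ^{[m]}(i)`. -/
theorem parenSet_subset_upperSet_bracketSet (n : ℕ) [NeZero n] (hn : 2 ≤ n)
    (h : Fin n → ℕ) (hconst : ∀ i j, h i = h j) (m : ℕ) (i : Fin n) :
    parenSet h m ⊆ upperSet (bracketSet h m i) := by
  induction m generalizing i with
  | zero => exact fun y hy => hy.elim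
  | succ m ih =>
    rintro y (hy | ⟨σ, x, ⟨hx, k, hk, a, ha, rfl⟩, hy⟩)
    · obtain ⟨g, hg, hgy⟩ := ih i hy
      exact ⟨g, Or.inr hg, hgy⟩
    rcases Nat.eq_zero_or_pos (y i) with hyi | hyi
    · set x := indGE n k + a
      have hyp : y (σ.symm (lastIdx n)) = 0 := by simp [hy, oneAt]
      set τ := (Equiv.swap i (σ.symm (lastIdx n))).trans σ with hτ
      obtain ⟨g, hg, hgx⟩ := comp_perm_mem_upperSet_sumset
        (fun _ hy => comp_perm_mem_parenSet hy) ih (oneAt_mem_bracketSet h m) hk.le ha τ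
      refine ⟨g - g i • oneAt i, Or.inl ⟨g, ⟨fun t => ?_, hg⟩, rfl⟩, fun t => ?_⟩
      · exact (hgx t).trans_lt ((hx (τ t)).trans_eq (hconst _ _))
      · by_cases hti : t = i
        · simp [hti, oneAt]
        have hgt : (g - g i • oneAt i) t = g t := by simp [oneAt, hti]
        rw [hgt]
        have hτt : τ t ≠ lastIdx n := by
          intro e
          apply hti
          apply τ.injective
          rw [e]
          simp [hτ]
        have hyt : y t = y (Equiv.swap i (σ.symm (lastIdx n)) t) := by
          by_cases htp : t = σ.symm (lastIdx n)
          · simp only [htp, Equiv.swap_apply_right, hyp, hyi]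
          · rw [Equiv.swap_apply_of_ne_of_ne hti htp]
        have hxt : y (Equiv.swap i (σ.symm (lastIdx n)) t) = x (τ t) := by
          have : σ (Equiv.swap i (σ.symm (lastIdx n)) t) ≠ lastIdx n := hτt
          simp [hy, oneAt, this, hτ]
        rw [hyt, hxt]
        exact hgx t
    · refine ⟨oneAt i, oneAt_mem_bracketSet h (m + 1) i, fun t => ?_⟩
      unfold oneAt
      split_ifs with hti
      · exact hti ▸ hyi
      · exact Nat.zero_le _
end

section
/- Let n ≥ 2, let ℏ : Fin n → ℕ be the constant function with value c, let 0 ≤ k < n, and let f : Fin n → ℕ be such that Ŝf ∈ ℏ^{(ω]} and the function 1_{n∖k} + k·(Ŝf) (pointwise sum and scalar multiple) takes all its values strictly below c. Then Ŝ(1_{n∖k} + k·(Ŝf)) ∈ ℏ^{(ω]}. -/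
/-- The shift operator `Ŝ`: `(Ŝf)(0) = 0` and `(Ŝf)(i) = f(i-1)` for `i > 0`. -/
def shiftFun {n : ℕ} (f : Fin n → ℕ) : Fin n → ℕ := fun i =>
  if (i : ℕ) = 0 then 0
  else f ⟨(i : ℕ) - 1, Nat.lt_of_le_of_lt (Nat.sub_le _ _) i.isLt⟩

theorem nsmul_mem_iterSumset {n : ℕ} {A : Set (Fin n → ℕ)} {g : Fin n → ℕ} (hg : g ∈ A) (k : ℕ) :
    k • g ∈ iterSumset A k := by
  induction k with
  | zero => simp [iterSumset]
  | succ k ih => exact ⟨g, hg, k • g, ih, succ_nsmul' g k⟩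

/-- The shift of `x` erases the last value of `x` and then rotates cyclically. -/
theorem shiftFun_eq_comp_finRotate_symm {n : ℕ} [NeZero n] (x : Fin n → ℕ) :
    shiftFun x = (x - x (lastIdx n) • oneAt (lastIdx n)) ∘ (finRotate n).symm := by
  obtain _ | m := n
  · exact absurd rfl (NeZero.ne 0)
  rw [Equiv.eq_comp_symm]
  funext j
  have hlast : lastIdx (m + 1) = Fin.last m := rfl
  rw [hlast]
  induction j using Fin.lastCases with
  | last => simp [shiftFun, oneAt]
  | cast j =>
    have hrot : finRotate (m + 1) j.castSucc = j.succ := by simp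
    simp only [Function.comp_apply, hrot]
    simp [shiftFun, oneAt, (Fin.castSucc_lt_last j).ne]
    rfl

/-- Lemma: for the constant function `ℏ ≡ c` and `0 ≤ k < n`, if `Ŝf ∈ ℏ^{(ω]}` and
`1_{n∖k} + k·(Ŝf)` takes all values strictly below `c`, then
`Ŝ(1_{n∖k} + k·(Ŝf)) ∈ ℏ^{(ω]}`. -/
theorem shift_mem_parenSet (n : ℕ) [NeZero n] (hn : 2 ≤ n) (c : ℕ)
    (k : ℕ) (hk : k < n) (f : Fin n → ℕ)
    (hf : shiftFun f ∈ ⋃ m : ℕ, parenSet (fun _ : Fin n => c) m)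
    (hlt : ∀ j, (indGE n k + k • shiftFun f) j < c) :
    shiftFun (indGE n k + k • shiftFun f) ∈ ⋃ m : ℕ, parenSet (fun _ : Fin n => c) m := by
  obtain ⟨m, hm⟩ := Set.mem_iUnion.mp hf
  exact Set.mem_iUnion.mpr ⟨m + 1, Or.inr ⟨(finRotate n).symm, _,
    ⟨hlt, k, hk, _, nsmul_mem_iterSumset hm k, rfl⟩, shiftFun_eq_comp_finRotate_symm _⟩⟩
end
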